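/- arXiv:1109.1617 — 3 statements merged into one kernel-verified Lean document; each statement's English description precedes it below -/
import Mathlib

section
/- Let {X(t)}_{t∈ℝ} be a centered Gaussian process whose trajectories are, with probability 1, continuous nowhere differentiable functions on ℝ. For each non-degenerate compact interval J define b_X(J) = sup{ b ≥ 0 : sup_{t',t''∈J, t'≠t''} E|X(t')−X(t'')|² / |t'−t''|^{2b} < ∞ }, and for s ∈ ℝ set ã_X(s) = sup{ b_X([u,v]) : u,v ∈ ℝ, s ∈ (u,v) }. Then there exists an event Ω̃ of probability 1, not depending on s, such that for all (s,ω) ∈ ℝ × Ω̃, the local Hölder exponent of the trajectory t ↦ X(t,ω) at s equals ã_X(s). -/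
open MeasureTheory ProbabilityTheory Filter Set Topology

noncomputable section

/-- A centered Gaussian process: every finite real-linear combination of its values
has a centered Gaussian distribution. -/
def IsCenteredGaussianProcess {Ω : Type*} [MeasurableSpace Ω] {T : Type*}
    (X : T → Ω → ℝ) (P : Measure Ω) : Prop :=
  ∀ (n : ℕ) (t : Fin n → T) (c : Fin n → ℝ), ∃ v : NNReal,
    Measure.map (fun ω => ∑ i, c i * X (t i) ω) P = gaussianReal 0 v

/-- The uniform Hölder exponent of `f` over `J`. -/
def uniformHolderExp (f : ℝ → ℝ) (J : Set ℝ) : ℝ :=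
  sSup {β : ℝ | 0 ≤ β ∧ ∃ C : ℝ, ∀ t' ∈ J, ∀ t'' ∈ J, t' ≠ t'' →
    |f t' - f t''| / |t' - t''| ^ β ≤ C}

/-- The local Hölder exponent of `f` at `s`:
`α̃_f(s) = sup{β_f([u,v]) : u,v ∈ ℝ, s ∈ (u,v)}`. -/
def localHolderExp (f : ℝ → ℝ) (s : ℝ) : ℝ :=
  sSup {x : ℝ | ∃ u v : ℝ, u < s ∧ s < v ∧ x = uniformHolderExp f (Set.Icc u v)}

/-- The deterministic exponent `b_X(J)`. -/
def gaussSupExp {Ω : Type*} [MeasurableSpace Ω] (P : Measure Ω) (X : ℝ → Ω → ℝ)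
    (J : Set ℝ) : ℝ :=
  sSup {b : ℝ | 0 ≤ b ∧ ∃ C : ℝ, ∀ t' ∈ J, ∀ t'' ∈ J, t' ≠ t'' →
    (∫ ω, (X t' ω - X t'' ω) ^ 2 ∂P) / |t' - t''| ^ (2 * b) ≤ C}

/-- The deterministic local exponent `ã_X(s) = sup{b_X([u,v]) : u,v ∈ ℝ, s ∈ (u,v)}`. -/
def gaussLocalExp {Ω : Type*} [MeasurableSpace Ω] (P : Measure Ω) (X : ℝ → Ω → ℝ)
    (s : ℝ) : ℝ :=
  sSup {x : ℝ | ∃ u v : ℝ, u < s ∧ s < v ∧ x = gaussSupExp P X (Set.Icc u v)}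

/-! ### Gaussian facts -/

lemma aemeas_of_map_gauss {Ω : Type*} [MeasurableSpace Ω] {P : Measure Ω} {Z : Ω → ℝ} {v : NNReal}
    (h : P.map Z = gaussianReal 0 v) : AEMeasurable Z P := by
  apply AEMeasurable.of_map_ne_zero
  rw [h]
  exact IsProbabilityMeasure.ne_zero _

lemma gauss_integrable_pow (v : NNReal) (k : ℕ) :
    Integrable (fun x : ℝ => x ^ (2 * k)) (gaussianReal 0 v) := by
  have h := (memLp_id_gaussianReal (μ := 0) (v := v) ((2 * k : ℕ) : NNReal))
  have h2 := h.integrable_norm_pow'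
  refine h2.congr (ae_of_all _ fun x => ?_)
  simp [pow_mul]

lemma gauss_moment (v : NNReal) (k : ℕ) :
    ∫ x, x ^ (2 * k) ∂(gaussianReal 0 v) =
      (v : ℝ) ^ k * ∫ x, x ^ (2 * k) ∂(gaussianReal 0 1) := by
  have h := gaussianReal_map_const_mul (μ := 0) (v := 1) (√(v : ℝ))
  have h2 : (⟨√(v : ℝ) ^ 2, sq_nonneg _⟩ : NNReal) * 1 = v := by
    ext
    simp
  have h3 : (gaussianReal 0 1).map (√(v : ℝ) * ·) = gaussianReal 0 v := by
    rw [h]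
    congr 1
    simp
  rw [← h3, integral_map (by fun_prop) (by fun_prop), ← integral_const_mul]
  congr 1
  ext x
  rw [mul_pow, pow_mul, Real.sq_sqrt v.coe_nonneg]

lemma gauss_second (v : NNReal) : ∫ x, x ^ 2 ∂(gaussianReal 0 v) = v := by
  have h := variance_fun_id_gaussianReal (μ := 0) (v := v)
  rw [variance_eq_integral measurable_id'.aemeasurable] at h
  simpa using h

lemma gauss_small_ball (v : NNReal) (hv : v ≠ 0) (ε : ℝ) (hε : 0 ≤ ε) :
    (gaussianReal 0 v).real (Icc (-ε) ε) ≤ 2 * ε * (√(v : ℝ))⁻¹ := by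
  have hv' : (0 : ℝ) < v := by positivity
  rw [measureReal_def, gaussianReal_apply_eq_integral _ hv, ENNReal.toReal_ofReal
    (integral_nonneg fun x => gaussianPDFReal_nonneg _ _ _)]
  have hb : ∀ x, gaussianPDFReal 0 v x ≤ (√(v : ℝ))⁻¹ := by
    intro x
    rw [gaussianPDFReal]
    have h1 : Real.exp (-(x - 0) ^ 2 / (2 * v)) ≤ 1 := by
      apply Real.exp_le_one_iff.2
      apply div_nonpos_of_nonpos_of_nonneg
      · nlinarith [sq_nonneg (x - 0)]
      · positivity
    have h2 : (√(2 * Real.pi * v))⁻¹ ≤ (√(v : ℝ))⁻¹ := by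
      apply inv_anti₀ (by positivity)
      apply Real.sqrt_le_sqrt
      nlinarith [Real.pi_gt_three]
    calc _ ≤ (√(2 * Real.pi * v))⁻¹ * 1 := by gcongr
      _ ≤ _ := by simpa using h2
  calc ∫ x in Icc (-ε) ε, gaussianPDFReal 0 v x
      ≤ ∫ x in Icc (-ε) ε, (√(v : ℝ))⁻¹ := by
        apply integral_mono (integrable_gaussianPDFReal _ _).restrict
        · apply integrable_const
        · intro x
          exact hb x
    _ = _ := by
        rw [setIntegral_const, measureReal_def, Real.volume_Icc,
          ENNReal.toReal_ofReal (by linarith), smul_eq_mul]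
        ring

/-! ### Deterministic chaining -/

lemma chaining (f : ℝ → ℝ) (hf : Continuous f) (M r : ℝ) (hM : 0 ≤ M) (hr0 : 0 < r) (hr : r < 1)
    (h : ∀ n : ℕ, ∀ i : ℕ, i < 2 ^ n → |f (((i : ℝ) + 1) / 2 ^ n) - f ((i : ℝ) / 2 ^ n)| ≤ M * r ^ n)
    (s t : ℝ) (hs : 0 ≤ s) (hst : s ≤ t) (ht : t ≤ 1) (n : ℕ) (hn : t - s ≤ (1 / 2) ^ n) :
    |f s - f t| ≤ (2 * (M / (1 - r)) + M) * r ^ n := by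
  have key : ∀ x, 0 ≤ x → x ≤ 1 → ∀ n : ℕ,
      |f ((⌊(2 : ℝ) ^ n * x⌋₊ : ℝ) / 2 ^ n) - f x| ≤ M / (1 - r) * r ^ n := by
    intro x hx0 hx1 n
    have hlim : Tendsto (fun n : ℕ => f ((⌊(2 : ℝ) ^ n * x⌋₊ : ℝ) / 2 ^ n)) atTop (𝓝 (f x)) := by
      apply (hf.tendsto x).comp
      have h1 := tendsto_nat_floor_mul_div_atTop (R := ℝ) hx0
      have h2 := h1.comp (tendsto_pow_atTop_atTop_of_one_lt (r := (2 : ℝ)) (by norm_num))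
      refine h2.congr fun n => ?_
      simp [mul_comm]
    have hd : ∀ n : ℕ, dist (f ((⌊(2 : ℝ) ^ n * x⌋₊ : ℝ) / 2 ^ n))
        (f ((⌊(2 : ℝ) ^ (n + 1) * x⌋₊ : ℝ) / 2 ^ (n + 1))) ≤ M * r ^ n := by
      intro n
      set m := ⌊(2 : ℝ) ^ n * x⌋₊ with hm
      have hm1 : (m : ℝ) ≤ 2 ^ n * x := Nat.floor_le (by positivity)
      have hm2 : 2 ^ n * x < m + 1 := Nat.lt_floor_add_one _
      set m' := ⌊(2 : ℝ) ^ (n + 1) * x⌋₊ with hm'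
      have hm1' : (m' : ℝ) ≤ 2 ^ (n + 1) * x := Nat.floor_le (by positivity)
      have hm2' : 2 ^ (n + 1) * x < m' + 1 := Nat.lt_floor_add_one _
      have hle : m' < 2 * m + 2 := by
        have : (m' : ℝ) < 2 * m + 2 := by rw [pow_succ] at hm1'; linarith
        exact_mod_cast this
      have hge : 2 * m < m' + 1 := by
        have : 2 * (m : ℝ) < m' + 1 := by rw [pow_succ] at hm2'; linarith
        exact_mod_cast this
      have hm'le : m' ≤ 2 ^ (n + 1) := by
        have : (m' : ℝ) ≤ 2 ^ (n + 1) := by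
          refine hm1'.trans ?_
          have : (0 : ℝ) < 2 ^ (n + 1) := by positivity
          nlinarith
        exact_mod_cast this
      have hcast : (m : ℝ) / 2 ^ n = ((2 * m : ℕ) : ℝ) / 2 ^ (n + 1) := by
        push_cast
        rw [pow_succ]
        field_simp
      have hmr : M * r ^ (n + 1) ≤ M * r ^ n :=
        mul_le_mul_of_nonneg_left (pow_le_pow_of_le_one hr0.le hr.le (Nat.le_succ n)) hM
      rcases (show m' = 2 * m ∨ m' = 2 * m + 1 by omega) with e | e
      · rw [hcast, e, dist_self]
        positivity
      · rw [hcast, e, Real.dist_eq, abs_sub_comm]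
        refine le_trans ?_ hmr
        have := h (n + 1) (2 * m) (by omega)
        push_cast at this ⊢
        exact this
    have := dist_le_of_le_geometric_of_tendsto r M hr hd hlim n
    rw [Real.dist_eq] at this
    refine this.trans (le_of_eq ?_)
    ring
  have ks := key s hs (hst.trans ht) n
  have kt := key t (hs.trans hst) ht n
  have hmid : |f ((⌊(2 : ℝ) ^ n * s⌋₊ : ℝ) / 2 ^ n) - f ((⌊(2 : ℝ) ^ n * t⌋₊ : ℝ) / 2 ^ n)|
      ≤ M * r ^ n := by
    have h2 : (0 : ℝ) < 2 ^ n := by positivity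
    set m := ⌊(2 : ℝ) ^ n * s⌋₊ with hm
    have hm1 : (m : ℝ) ≤ 2 ^ n * s := Nat.floor_le (by positivity)
    have hm2 : 2 ^ n * s < m + 1 := Nat.lt_floor_add_one _
    have ht0 : 0 ≤ t := hs.trans hst
    set m' := ⌊(2 : ℝ) ^ n * t⌋₊ with hm'
    have hm1' : (m' : ℝ) ≤ 2 ^ n * t := Nat.floor_le (by positivity)
    have hge : m ≤ m' := Nat.floor_mono (by gcongr)
    have hdiff : 2 ^ n * t ≤ 2 ^ n * s + 1 := by
      have : (2 : ℝ) ^ n * (t - s) ≤ 2 ^ n * (1 / 2) ^ n := by gcongr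
      rw [← mul_pow] at this
      norm_num at this
      linarith
    have hle : m' < m + 2 := by
      have : (m' : ℝ) < m + 2 := by linarith
      exact_mod_cast this
    have hm'le : m' ≤ 2 ^ n := by
      have : (m' : ℝ) ≤ 2 ^ n := by nlinarith
      exact_mod_cast this
    rcases (show m' = m ∨ m' = m + 1 by omega) with e | e
    · rw [e, sub_self, abs_zero]
      positivity
    · rw [e, abs_sub_comm]
      have := h n m (by omega)
      push_cast
      exact this
  rw [abs_le] at *
  constructor <;> nlinarith

lemma holder_unit (f : ℝ → ℝ) (hf : Continuous f) (M q : ℝ) (hM : 0 ≤ M) (hq : 0 < q)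
    (h : ∀ n : ℕ, ∀ i : ℕ, i < 2 ^ n → |f (((i : ℝ) + 1) / 2 ^ n) - f ((i : ℝ) / 2 ^ n)|
      ≤ M * (((1 / 2 : ℝ) ^ q)) ^ n) :
    ∃ C, 0 ≤ C ∧ ∀ s t : ℝ, 0 ≤ s → s < t → t ≤ 1 → |f s - f t| ≤ C * (t - s) ^ q := by
  set r : ℝ := (1 / 2 : ℝ) ^ q with hr
  have hr0 : 0 < r := by positivity
  have hr1 : r < 1 := Real.rpow_lt_one (by norm_num) (by norm_num) hq
  have h1r : 0 < 1 - r := by linarith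
  refine ⟨(2 * (M / (1 - r)) + M) * r⁻¹, by positivity, fun s t hs hst ht => ?_⟩
  obtain ⟨n, hn1, hn2⟩ := exists_nat_pow_near_of_lt_one (x := t - s) (y := (1 / 2 : ℝ))
    (by linarith) (by linarith) (by norm_num) (by norm_num)
  have h1 := chaining f hf M r hM hr0 hr1 h s t hs hst.le ht n hn2
  refine h1.trans ?_
  rw [mul_assoc]
  gcongr
  rw [inv_mul_eq_div, le_div_iff₀ hr0, ← pow_succ, hr, ← Real.rpow_natCast, ← Real.rpow_mul
    (by norm_num), mul_comm, Real.rpow_mul (by norm_num), Real.rpow_natCast]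
  gcongr

/-! ### Kolmogorov -/

lemma kolm {Ω : Type*} [MeasurableSpace Ω] (P : Measure Ω) (D : ℕ → ℕ → Ω → ℝ) (K ρ r : ℝ)
    (hK : 0 ≤ K) (hρ : 0 < ρ) (hρr : ρ < r)
    (h : ∀ n i, ∃ v : NNReal, P.map (D n i) = gaussianReal 0 v ∧
      (i < 2 ^ n → (v : ℝ) ≤ K * (ρ ^ 2) ^ n)) :
    ∀ᵐ ω ∂P, ∃ M, 0 ≤ M ∧ ∀ n : ℕ, ∀ i : ℕ, i < 2 ^ n → |D n i ω| ≤ M * r ^ n := by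
  have hr : 0 < r := hρ.trans hρr
  have hθ0 : 0 < (ρ / r) ^ 2 := by positivity
  have hθ1 : (ρ / r) ^ 2 < 1 := by
    apply pow_lt_one₀ (by positivity) ((div_lt_one hr).2 hρr) (by norm_num)
  obtain ⟨k, hk⟩ := exists_pow_lt_of_lt_one (show (0 : ℝ) < 1 / 2 by norm_num) hθ1
  have hk0 : k ≠ 0 := by
    rintro rfl
    norm_num at hk
  set c := ∫ x, x ^ (2 * k) ∂(gaussianReal 0 1) with hc
  have hc0 : 0 ≤ c := integral_nonneg fun x => by
    simp only [pow_mul]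
    exact pow_nonneg (sq_nonneg x) k
  let F : ℕ → ℕ → Ω → ENNReal := fun n i ω => ENNReal.ofReal ((D n i ω / r ^ n) ^ (2 * k))
  have hDm : ∀ n i, AEMeasurable (D n i) P := fun n i => by
    obtain ⟨v, hv, -⟩ := h n i
    exact aemeas_of_map_gauss hv
  have hFm : ∀ n i, AEMeasurable (F n i) P := fun n i =>
    (((hDm n i).div_const _).pow_const _).ennreal_ofReal
  set γ := 2 * ((ρ / r) ^ 2) ^ k with hγ
  have hγ0 : 0 ≤ γ := by positivity
  have hγ1 : γ < 1 := by linarith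
  have hFi : ∀ n, ∀ i : ℕ, i < 2 ^ n → ∫⁻ ω, F n i ω ∂P ≤
      ENNReal.ofReal (c * K ^ k * (((ρ / r) ^ 2) ^ k) ^ n) := by
    intro n i hi
    obtain ⟨v, hv, hvle⟩ := h n i
    have e1 : ∫⁻ ω, F n i ω ∂P = ∫⁻ x, ENNReal.ofReal ((x / r ^ n) ^ (2 * k)) ∂(gaussianReal 0 v) := by
      rw [← hv, lintegral_map' (by fun_prop) (hDm n i)]
    rw [e1, ← ofReal_integral_eq_lintegral_ofReal]
    · apply ENNReal.ofReal_le_ofReal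
      simp_rw [div_pow]
      rw [integral_div, gauss_moment, ← hc]
      have h1 : (v : ℝ) ^ k ≤ (K * (ρ ^ 2) ^ n) ^ k := by
        gcongr
        exact hvle hi
      rw [div_le_iff₀ (by positivity)]
      calc (v : ℝ) ^ k * c ≤ (K * (ρ ^ 2) ^ n) ^ k * c := by gcongr
        _ = _ := by
          rw [mul_pow]
          field_simp
          ring
    · simp_rw [div_pow]
      exact (gauss_integrable_pow v k).div_const _
    · exact ae_of_all _ fun x => by
        simp only [pow_mul]
        exact pow_nonneg (sq_nonneg _) k
  have hsum : ∫⁻ ω, ∑' n, ∑ i ∈ Finset.range (2 ^ n), F n i ω ∂P ≠ ⊤ := by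
    rw [lintegral_tsum fun n => Finset.aemeasurable_fun_sum _ fun i _ => hFm n i]
    have hle : ∀ n, ∫⁻ ω, ∑ i ∈ Finset.range (2 ^ n), F n i ω ∂P ≤
        ENNReal.ofReal (c * K ^ k * γ ^ n) := by
      intro n
      rw [lintegral_finsetSum' _ fun i _ => hFm n i]
      calc _ ≤ ∑ i ∈ Finset.range (2 ^ n), ENNReal.ofReal (c * K ^ k * (((ρ / r) ^ 2) ^ k) ^ n) :=
            Finset.sum_le_sum fun i hi => hFi n i (Finset.mem_range.1 hi)
        _ = _ := by
          rw [Finset.sum_const, Finset.card_range, ← ENNReal.ofReal_nsmul]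
          congr 1
          rw [hγ, mul_pow, nsmul_eq_mul]
          push_cast
          ring
    refine ne_top_of_le_ne_top ?_ (ENNReal.tsum_le_tsum hle)
    exact ((summable_geometric_of_lt_one hγ0 hγ1).mul_left _).tsum_ofReal_ne_top
  have hae := ae_lt_top' (AEMeasurable.tsum fun n =>
    Finset.aemeasurable_fun_sum _ fun i _ => hFm n i) hsum
  filter_upwards [hae] with ω hω
  set S := ∑' n, ∑ i ∈ Finset.range (2 ^ n), F n i ω with hS
  refine ⟨S.toReal + 1, by positivity, fun n i hi => ?_⟩
  have h1 : F n i ω ≤ S :=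
    (Finset.single_le_sum (f := fun i => F n i ω) (fun _ _ => zero_le)
      (Finset.mem_range.2 hi)).trans (ENNReal.le_tsum n)
  have h2 : (D n i ω / r ^ n) ^ (2 * k) ≤ S.toReal := by
    have := (ENNReal.ofReal_le_iff_le_toReal hω.ne).1 h1
    exact this
  have h3 : |D n i ω / r ^ n| ≤ S.toReal + 1 := by
    have hS0 : 0 ≤ S.toReal := ENNReal.toReal_nonneg
    by_contra! hcon
    have h4 : (S.toReal + 1) ^ (2 * k) < |D n i ω / r ^ n| ^ (2 * k) := by
      gcongr
    rw [pow_mul |D n i ω / r ^ n|, sq_abs, ← pow_mul] at h4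
    have h5 : S.toReal + 1 ≤ (S.toReal + 1) ^ (2 * k) :=
      le_self_pow₀ (by linarith) (by omega)
    linarith
  rw [abs_div, abs_of_pos (pow_pos hr n), div_le_iff₀ (pow_pos hr n)] at h3
  exact h3

/-! ### Assembling -/

/-- The Hölder condition used in `uniformHolderExp`. -/
def HoldC (f : ℝ → ℝ) (J : Set ℝ) (β : ℝ) : Prop :=
  ∃ C : ℝ, ∀ t' ∈ J, ∀ t'' ∈ J, t' ≠ t'' → |f t' - f t''| / |t' - t''| ^ β ≤ C

/-- The variance condition used in `gaussSupExp`. -/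
def VarC {Ω : Type*} [MeasurableSpace Ω] (P : Measure Ω) (X : ℝ → Ω → ℝ)
    (J : Set ℝ) (b : ℝ) : Prop :=
  ∃ C : ℝ, ∀ t' ∈ J, ∀ t'' ∈ J, t' ≠ t'' →
    (∫ ω, (X t' ω - X t'' ω) ^ 2 ∂P) / |t' - t''| ^ (2 * b) ≤ C

lemma HoldC.mono {f : ℝ → ℝ} {J J' : Set ℝ} {β : ℝ} (h : HoldC f J β) (hJ : J' ⊆ J) :
    HoldC f J' β := by
  obtain ⟨C, hC⟩ := h
  exact ⟨C, fun t ht t' ht' => hC t (hJ ht) t' (hJ ht')⟩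

lemma VarC.mono {Ω : Type*} [MeasurableSpace Ω] {P : Measure Ω} {X : ℝ → Ω → ℝ}
    {J J' : Set ℝ} {β : ℝ} (h : VarC P X J β) (hJ : J' ⊆ J) :
    VarC P X J' β := by
  obtain ⟨C, hC⟩ := h
  exact ⟨C, fun t ht t' ht' => hC t (hJ ht) t' (hJ ht')⟩

lemma HoldC.bound {f : ℝ → ℝ} {J : Set ℝ} {β : ℝ} (h : HoldC f J β) :
    ∃ C : ℝ, 0 ≤ C ∧ ∀ t' ∈ J, ∀ t'' ∈ J, t' ≠ t'' → |f t' - f t''| ≤ C * |t' - t''| ^ β := by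
  obtain ⟨C, hC⟩ := h
  refine ⟨max C 0, le_max_right _ _, fun t ht t' ht' hne => ?_⟩
  have h0 : 0 < |t - t'| ^ β := Real.rpow_pos_of_pos (abs_pos.2 (sub_ne_zero.2 hne)) _
  exact (div_le_iff₀ h0).1 ((hC t ht t' ht' hne).trans (le_max_left _ _))

lemma HoldC.lower {f : ℝ → ℝ} {u v : ℝ} {β q : ℝ} (h : HoldC f (Icc u v) β) (hq : q ≤ β) :
    HoldC f (Icc u v) q := by
  obtain ⟨C, hC0, hC⟩ := h.bound
  refine ⟨C * (v - u) ^ (β - q), fun t ht t' ht' hne => ?_⟩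
  have hp : 0 < |t - t'| := abs_pos.2 (sub_ne_zero.2 hne)
  have h0 : 0 < |t - t'| ^ q := Real.rpow_pos_of_pos hp _
  rw [div_le_iff₀ h0]
  refine (hC t ht t' ht' hne).trans ?_
  have e : |t - t'| ^ β = |t - t'| ^ (β - q) * |t - t'| ^ q := by
    rw [← Real.rpow_add hp]
    ring_nf
  rw [e, ← mul_assoc]
  have hle : |t - t'| ≤ v - u := by
    rw [abs_le]
    constructor <;> linarith [ht.1, ht.2, ht'.1, ht'.2]
  gcongr

lemma HoldC.zero {f : ℝ → ℝ} (hf : Continuous f) (u v : ℝ) : HoldC f (Icc u v) 0 := by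
  obtain ⟨C, hC⟩ := (isCompact_Icc (a := u) (b := v)).exists_bound_of_continuousOn hf.continuousOn
  refine ⟨C + C, fun t ht t' ht' _ => ?_⟩
  rw [Real.rpow_zero, div_one]
  exact (abs_sub _ _).trans (add_le_add (hC t ht) (hC t' ht'))

lemma HoldC.le_one {f : ℝ → ℝ} {u v s β : ℝ} (h : HoldC f (Icc u v) β) (hs : s ∈ Ioo u v)
    (hd : ¬ DifferentiableAt ℝ f s) : β ≤ 1 := by
  by_contra! hβ
  apply hd
  obtain ⟨C, hC0, hC⟩ := h.bound
  have hz : Tendsto (fun t : ℝ => C * |t - s| ^ (β - 1)) (𝓝[≠] s) (𝓝 0) := by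
    have hc : Continuous (fun t : ℝ => C * |t - s| ^ (β - 1)) := by
      apply continuous_const.mul
      exact (by fun_prop : Continuous fun t : ℝ => |t - s|).rpow_const
        (fun x => Or.inr (by linarith))
    have := hc.tendsto s
    simp only [sub_self, abs_zero, Real.zero_rpow (by linarith : β - 1 ≠ 0), mul_zero] at this
    exact this.mono_left nhdsWithin_le_nhds
  have hder : HasDerivAt f 0 s := by
    rw [hasDerivAt_iff_tendsto_slope]
    refine squeeze_zero_norm' ?_ hz
    have hmem : Ioo u v ∈ 𝓝[≠] s := mem_nhdsWithin_of_mem_nhds (Ioo_mem_nhds hs.1 hs.2)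
    filter_upwards [hmem, self_mem_nhdsWithin] with t ht hts
    have hp : 0 < |t - s| := abs_pos.2 (sub_ne_zero.2 hts)
    rw [slope_def_field, Real.norm_eq_abs, abs_div, div_le_iff₀ hp, mul_assoc]
    have e : |t - s| ^ (β - 1) * |t - s| = |t - s| ^ β := by
      conv_lhs => rw [← Real.rpow_one |t - s|, Real.rpow_one, ← Real.rpow_add_one hp.ne']
      ring_nf
    rw [e]
    exact hC t (Ioo_subset_Icc_self ht) s (Ioo_subset_Icc_self hs) hts
  exact hder.differentiableAt

section Increments

variable {Ω : Type*} [MeasurableSpace Ω] {P : Measure Ω} [IsProbabilityMeasure P]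
  {X : ℝ → Ω → ℝ}

lemma incr_gauss (hG : IsCenteredGaussianProcess X P) (s t : ℝ) :
    ∃ v : NNReal, P.map (fun ω => X s ω - X t ω) = gaussianReal 0 v ∧
      ∫ ω, (X s ω - X t ω) ^ 2 ∂P = v := by
  obtain ⟨v, hv⟩ := hG 2 ![s, t] ![1, -1]
  have e : (fun ω => ∑ i, (![1, -1] : Fin 2 → ℝ) i * X ((![s, t] : Fin 2 → ℝ) i) ω)
      = fun ω => X s ω - X t ω := by
    ext ω
    simp [Fin.sum_univ_two, sub_eq_add_neg]
  rw [e] at hv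
  refine ⟨v, hv, ?_⟩
  rw [← gauss_second v, ← hv, integral_map (aemeas_of_map_gauss hv) (by fun_prop)]

lemma holder_of_var (hG : IsCenteredGaussianProcess X P)
    (hc : ∀ᵐ ω ∂P, Continuous (fun t => X t ω)) {u v b q : ℝ} (huv : u < v) (hq : 0 ≤ q)
    (hqb : q < b) (hV : VarC P X (Icc u v) b) :
    ∀ᵐ ω ∂P, HoldC (fun t => X t ω) (Icc u v) q := by
  rcases hq.eq_or_lt with rfl | hq
  · filter_upwards [hc] with ω hω using HoldC.zero hω u v
  obtain ⟨C, hC⟩ := hV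
  have hl : 0 < v - u := by linarith
  let p : ℝ → ℝ := fun x => u + (v - u) * x
  let D : ℕ → ℕ → Ω → ℝ := fun n i ω =>
    X (p (((i : ℝ) + 1) / 2 ^ n)) ω - X (p ((i : ℝ) / 2 ^ n)) ω
  have hk := kolm P D (max C 0 * (v - u) ^ (2 * b)) ((1 / 2 : ℝ) ^ b) ((1 / 2 : ℝ) ^ q)
    (by positivity) (by positivity)
    (Real.rpow_lt_rpow_of_exponent_gt (by norm_num) (by norm_num) hqb) ?_
  · filter_upwards [hk, hc] with ω hω hcω
    obtain ⟨M, hM, hMD⟩ := hω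
    obtain ⟨C', hC'0, hC'⟩ := holder_unit (fun x => X (p x) ω)
      (hcω.comp (by fun_prop : Continuous p)) M q hM hq hMD
    have main : ∀ t ∈ Icc u v, ∀ t' ∈ Icc u v, t < t' →
        |X t ω - X t' ω| ≤ C' * ((v - u) ^ q)⁻¹ * |t - t'| ^ q := by
      intro t ht t' ht' htt
      have h1 := hC' ((t - u) / (v - u)) ((t' - u) / (v - u))
        (div_nonneg (by linarith [ht.1]) hl.le) (by gcongr)
        ((div_le_one hl).2 (by linarith [ht'.2]))
      have e1 : ∀ x, p ((x - u) / (v - u)) = x := fun x => by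
        simp only [p]
        field_simp
        ring
      simp only [e1] at h1
      refine h1.trans (le_of_eq ?_)
      rw [← sub_div, Real.div_rpow (by linarith) hl.le, abs_sub_comm, abs_of_pos (by linarith)]
      ring_nf
    refine ⟨C' * ((v - u) ^ q)⁻¹, fun t ht t' ht' hne => ?_⟩
    rw [div_le_iff₀ (Real.rpow_pos_of_pos (abs_pos.2 (sub_ne_zero.2 hne)) _)]
    rcases lt_or_gt_of_ne hne with h | h
    · exact main t ht t' ht' h
    · rw [abs_sub_comm, abs_sub_comm t]
      exact main t' ht' t ht h
  · intro n i
    obtain ⟨w, hw, hw2⟩ := incr_gauss hG (p (((i : ℝ) + 1) / 2 ^ n)) (p ((i : ℝ) / 2 ^ n))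
    refine ⟨w, hw, fun hi => ?_⟩
    have hi' : (i : ℝ) + 1 ≤ 2 ^ n := by exact_mod_cast hi
    have hp : ∀ x, 0 ≤ x → x ≤ 1 → p x ∈ Icc u v := by
      intro x h0 h1
      simp only [p]
      constructor <;> nlinarith
    have h2n : (0 : ℝ) < 2 ^ n := by positivity
    have hd : p (((i : ℝ) + 1) / 2 ^ n) - p ((i : ℝ) / 2 ^ n) = (v - u) * (1 / 2) ^ n := by
      simp only [p]
      rw [one_div_pow]
      field_simp
      ring
    have hdp : 0 < (v - u) * (1 / 2 : ℝ) ^ n := by positivity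
    have h1 := hC _ (hp (((i : ℝ) + 1) / 2 ^ n) (by positivity) ((div_le_one h2n).2 hi'))
      _ (hp ((i : ℝ) / 2 ^ n) (by positivity) ((div_le_one h2n).2 (by linarith)))
      (sub_ne_zero.1 (by rw [hd]; exact hdp.ne'))
    rw [hw2, hd, abs_of_pos hdp, div_le_iff₀ (by positivity)] at h1
    calc (w : ℝ) ≤ C * ((v - u) * (1 / 2) ^ n) ^ (2 * b) := h1
      _ ≤ max C 0 * ((v - u) * (1 / 2) ^ n) ^ (2 * b) := by
        gcongr
        exact le_max_left _ _
      _ = _ := by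
        rw [Real.mul_rpow hl.le (by positivity), ← mul_assoc]
        congr 1
        rw [← pow_mul, ← Real.rpow_natCast, ← Real.rpow_natCast, ← Real.rpow_mul (by norm_num),
          ← Real.rpow_mul (by norm_num)]
        congr 1
        push_cast
        ring

lemma not_holder_of_not_var (hG : IsCenteredGaussianProcess X P) {J : Set ℝ} {q : ℝ}
    (hV : ¬ VarC P X J q) :
    ∀ᵐ ω ∂P, ¬ HoldC (fun t => X t ω) J q := by
  by_contra hcon
  apply hV
  let A : ℕ → Set Ω := fun N => {ω | ∀ t ∈ J, ∀ t' ∈ J, t ≠ t' →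
    |X t ω - X t' ω| ≤ N * |t - t'| ^ q}
  have hA : ∃ N, P (A N) ≠ 0 := by
    by_contra! hA
    apply hcon
    have h1 : ∀ᵐ ω ∂P, ∀ N, ω ∉ A N := ae_all_iff.2 fun N => measure_eq_zero_iff_ae_notMem.1 (hA N)
    filter_upwards [h1] with ω hω hH
    obtain ⟨C, hC0, hC⟩ := hH.bound
    obtain ⟨N, hN⟩ := exists_nat_ge C
    refine hω N fun t ht t' ht' hne => (hC t ht t' ht' hne).trans ?_
    gcongr
  obtain ⟨N, hN⟩ := hA
  have hp : 0 < P.real (A N) := ENNReal.toReal_pos hN (measure_ne_top _ _)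
  refine ⟨(2 * N / P.real (A N)) ^ 2, fun t ht t' ht' hne => ?_⟩
  have hd : 0 < |t - t'| := abs_pos.2 (sub_ne_zero.2 hne)
  obtain ⟨w, hw, hw2⟩ := incr_gauss hG t t'
  rw [hw2]
  have h0 : 0 < |t - t'| ^ q := Real.rpow_pos_of_pos hd _
  have e2 : |t - t'| ^ (2 * q) = (|t - t'| ^ q) ^ 2 := by
    rw [mul_comm, Real.rpow_mul hd.le, Real.rpow_two]
  rw [e2]
  rcases eq_or_ne w 0 with rfl | hw0
  · simp only [NNReal.coe_zero, zero_div]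
    positivity
  have hwp : (0 : ℝ) < √(w : ℝ) := by positivity
  have h1 : P.real (A N) ≤ (gaussianReal 0 w).real
      (Icc (-(N * |t - t'| ^ q)) (N * |t - t'| ^ q)) := by
    rw [← hw, measureReal_def, measureReal_def, Measure.map_apply_of_aemeasurable
      (aemeas_of_map_gauss hw) measurableSet_Icc]
    apply ENNReal.toReal_mono (measure_ne_top _ _)
    apply measure_mono
    intro ω hω
    exact abs_le.1 (hω t ht t' ht' hne)
  have h2 := h1.trans (gauss_small_ball w hw0 _ (by positivity))
  rw [← div_eq_mul_inv, le_div_iff₀ hwp] at h2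
  rw [div_le_iff₀ (by positivity), ← mul_pow, ← Real.sq_sqrt w.coe_nonneg]
  gcongr
  rw [div_mul_eq_mul_div, le_div_iff₀ hp]
  linarith

end Increments

/-- There is an event of probability 1, not depending on `s`, on which the local
Hölder exponent of every trajectory at every point `s` equals `ã_X(s)`. -/
theorem local_holder_exponent_deterministic
    {Ω : Type*} [MeasurableSpace Ω] (P : Measure Ω) [IsProbabilityMeasure P]
    (X : ℝ → Ω → ℝ)
    (hGauss : IsCenteredGaussianProcess X P)
    (hpath : ∀ᵐ ω ∂P, Continuous (fun t => X t ω) ∧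
      ∀ t : ℝ, ¬ DifferentiableAt ℝ (fun u => X u ω) t) :
    ∃ E : Set Ω, MeasurableSet E ∧ P E = 1 ∧
      ∀ (s : ℝ), ∀ ω ∈ E, localHolderExp (fun t => X t ω) s = gaussLocalExp P X s := by
  have hcont : ∀ᵐ ω ∂P, Continuous (fun t => X t ω) := hpath.mono fun ω h => h.1
  have h1 : ∀ᵐ ω ∂P, ∀ u v q : ℚ, (u : ℝ) < v → (0 : ℝ) ≤ q →
      (∃ b : ℝ, (q : ℝ) < b ∧ VarC P X (Icc (u : ℝ) v) b) →
      HoldC (fun t => X t ω) (Icc (u : ℝ) v) q := by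
    refine ae_all_iff.2 fun u => ae_all_iff.2 fun v => ae_all_iff.2 fun q => ?_
    by_cases H : (u : ℝ) < v ∧ (0 : ℝ) ≤ q ∧ ∃ b : ℝ, (q : ℝ) < b ∧ VarC P X (Icc (u : ℝ) v) b
    · obtain ⟨huv, hq, b, hqb, hb⟩ := H
      filter_upwards [holder_of_var hGauss hcont huv hq hqb hb] with ω hω _ _ _ using hω
    · exact ae_of_all _ fun ω a b c => absurd ⟨a, b, c⟩ H
  have h2 : ∀ᵐ ω ∂P, ∀ u v q : ℚ, HoldC (fun t => X t ω) (Icc (u : ℝ) v) q →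
      VarC P X (Icc (u : ℝ) v) q := by
    refine ae_all_iff.2 fun u => ae_all_iff.2 fun v => ae_all_iff.2 fun q => ?_
    by_cases H : VarC P X (Icc (u : ℝ) v) q
    · exact ae_of_all _ fun ω _ => H
    · filter_upwards [not_holder_of_not_var hGauss H] with ω hω h using absurd h hω
  obtain ⟨E, hEae, hEm, hEsub⟩ := (hpath.and (h1.and h2)).exists_measurable_mem
  have hE1 : P E = 1 := (mem_ae_iff_prob_eq_one hEm).1 hEae
  refine ⟨E, hEm, hE1, fun s ω hω => ?_⟩
  obtain ⟨⟨hc, hnd⟩, H1, H2⟩ := hEsub ω hω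
  set f : ℝ → ℝ := fun t => X t ω with hf
  have hrat : ∀ u v : ℝ, u < s → s < v → ∃ u' v' : ℚ, (u' : ℝ) < s ∧ s < v' ∧
      Icc (u' : ℝ) v' ⊆ Icc u v := by
    intro u v hu hv
    obtain ⟨u', hu1, hu2⟩ := exists_rat_btwn hu
    obtain ⟨v', hv1, hv2⟩ := exists_rat_btwn hv
    exact ⟨u', v', hu2, hv1, Icc_subset_Icc hu1.le hv2.le⟩
  -- boundedness of the exponent sets
  have hHb : ∀ u v : ℝ, u < s → s < v → ∀ β, HoldC f (Icc u v) β → β ≤ 1 :=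
    fun u v hu hv β hβ => hβ.le_one ⟨hu, hv⟩ (hnd s)
  -- transfer from variance to trajectories
  have hVH : ∀ u v : ℝ, u < s → s < v → ∀ b, VarC P X (Icc u v) b → ∀ q : ℚ, (0 : ℝ) ≤ q →
      (q : ℝ) < b → ∃ u' v' : ℝ, u' < s ∧ s < v' ∧ HoldC f (Icc u' v') q := by
    intro u v hu hv b hb q hq hqb
    obtain ⟨u', v', hu', hv', hsub⟩ := hrat u v hu hv
    exact ⟨u', v', hu', hv', H1 u' v' q (hu'.trans hv') hq ⟨b, hqb, hb.mono hsub⟩⟩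
  have hHV : ∀ u v : ℝ, u < s → s < v → ∀ b, HoldC f (Icc u v) b → ∀ q : ℚ, 
      (q : ℝ) < b → ∃ u' v' : ℝ, u' < s ∧ s < v' ∧ VarC P X (Icc u' v') q := by
    intro u v hu hv b hb q hqb
    obtain ⟨u', v', hu', hv', hsub⟩ := hrat u v hu hv
    exact ⟨u', v', hu', hv', H2 u' v' q ((hb.lower hqb.le).mono hsub)⟩
  have hVb : ∀ u v : ℝ, u < s → s < v → ∀ b, VarC P X (Icc u v) b → b ≤ 1 := by
    intro u v hu hv b hb
    by_contra! hcon
    obtain ⟨q, hq1, hq2⟩ := exists_rat_btwn hcon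
    obtain ⟨u', v', hu', hv', hH⟩ := hVH u v hu hv b hb q (by linarith) hq2
    linarith [hHb u' v' hu' hv' q hH]
  have hL1 : ∀ u v : ℝ, u < s → s < v → uniformHolderExp f (Icc u v) ≤ 1 := fun u v hu hv =>
    Real.sSup_le (fun β hβ => hHb u v hu hv β hβ.2) zero_le_one
  have hA1 : ∀ u v : ℝ, u < s → s < v → gaussSupExp P X (Icc u v) ≤ 1 := fun u v hu hv =>
    Real.sSup_le (fun β hβ => hVb u v hu hv β hβ.2) zero_le_one
  have hLge : ∀ u v : ℝ, u < s → s < v → ∀ β, 0 ≤ β → HoldC f (Icc u v) β →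
      β ≤ localHolderExp f s := by
    intro u v hu hv β h0 hβ
    refine le_trans (b := uniformHolderExp f (Icc u v)) ?_ ?_
    · exact le_csSup ⟨1, fun x hx => hHb u v hu hv x hx.2⟩ ⟨h0, hβ⟩
    · refine le_csSup ⟨1, ?_⟩ ⟨u, v, hu, hv, rfl⟩
      rintro x ⟨u', v', hu', hv', rfl⟩
      exact hL1 u' v' hu' hv'
  have hAge : ∀ u v : ℝ, u < s → s < v → ∀ β, 0 ≤ β → VarC P X (Icc u v) β →
      β ≤ gaussLocalExp P X s := by
    intro u v hu hv β h0 hβ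
    refine le_trans (b := gaussSupExp P X (Icc u v)) ?_ ?_
    · exact le_csSup ⟨1, fun x hx => hVb u v hu hv x hx.2⟩ ⟨h0, hβ⟩
    · refine le_csSup ⟨1, ?_⟩ ⟨u, v, hu, hv, rfl⟩
      rintro x ⟨u', v', hu', hv', rfl⟩
      exact hA1 u' v' hu' hv'
  have hLpos : 0 ≤ localHolderExp f s := by
    refine Real.sSup_nonneg ?_
    rintro x ⟨u, v, -, -, rfl⟩
    exact Real.sSup_nonneg fun β hβ => hβ.1
  have hApos : 0 ≤ gaussLocalExp P X s := by
    refine Real.sSup_nonneg ?_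
    rintro x ⟨u, v, -, -, rfl⟩
    exact Real.sSup_nonneg fun β hβ => hβ.1
  apply le_antisymm
  · refine Real.sSup_le ?_ hApos
    rintro x ⟨u, v, hu, hv, rfl⟩
    refine Real.sSup_le ?_ hApos
    rintro β ⟨-, hβ⟩
    by_contra! hcon
    obtain ⟨q, hq1, hq2⟩ := exists_rat_btwn hcon
    obtain ⟨u', v', hu', hv', hV⟩ := hHV u v hu hv β hβ q hq2
    linarith [hAge u' v' hu' hv' q (by linarith) hV]
  · refine Real.sSup_le ?_ hLpos
    rintro x ⟨u, v, hu, hv, rfl⟩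
    refine Real.sSup_le ?_ hLpos
    rintro β ⟨-, hβ⟩
    by_contra! hcon
    obtain ⟨q, hq1, hq2⟩ := exists_rat_btwn hcon
    obtain ⟨u', v', hu', hv', hH⟩ := hVH u v hu hv β hβ q (by linarith) hq2
    linarith [hLge u' v' hu' hv' q (by linarith) hH]

end
end

section
/- There exist a centered Gaussian random field {B̃(t,θ)}_{(t,θ)∈ℝ×(0,1)} with covariance E[B̃(t,θ)B̃(t',θ')] = ∫_ℝ ((t−x)₊^{θ−1/2} − (−x)₊^{θ−1/2})((t'−x)₊^{θ'−1/2} − (−x)₊^{θ'−1/2}) dx, and an event Ω* of probability 1 not depending on s and θ, such that for each ω ∈ Ω* and for all (s,θ) ∈ ℝ × (0,1), the pointwise Hölder exponent at s of the function t ↦ B̃(t,θ,ω) equals θ. (For each fixed θ, {B̃(t,θ)}_{t∈ℝ} is a fractional Brownian motion of Hurst parameter θ.) -/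
open MeasureTheory ProbabilityTheory Filter Set Topology

noncomputable section

/-- `u₊^a`: equals `u^a` if `u > 0` and `0` otherwise. -/
def posRPow (u a : ℝ) : ℝ := if 0 < u then u ^ a else 0

/-- The fBm-type kernel `x ↦ (t−x)₊^{θ−1/2} − (−x)₊^{θ−1/2}`. -/
def fbmKernel (θ t x : ℝ) : ℝ := posRPow (t - x) (θ - 1/2) - posRPow (-x) (θ - 1/2)

/-- The pointwise Hölder exponent of `f` at `s`:
`α_f(s) = sup{α ≥ 0 : limsup_{h→0} |f(s+h)−f(s)|/|h|^α = 0}`. -/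
def pointwiseHolderExp (f : ℝ → ℝ) (s : ℝ) : ℝ :=
  sSup {α : ℝ | 0 ≤ α ∧
    Filter.Tendsto (fun h : ℝ => |f (s + h) - f s| / |h| ^ α) (𝓝[≠] 0) (𝓝 0)}

theorem charFun_map_dist_le {Ω : Type*} [MeasurableSpace Ω] {P : Measure Ω}
    [IsProbabilityMeasure P] (f g : Lp ℝ 2 P) (t : ℝ) :
    ‖charFun (P.map f) t - charFun (P.map g) t‖ ≤ |t| * ‖f - g‖ := by
  have hf : AEMeasurable f P := (Lp.aestronglyMeasurable f).aemeasurable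
  have hg : AEMeasurable g P := (Lp.aestronglyMeasurable g).aemeasurable
  rw [charFun_apply_real, charFun_apply_real, integral_map hf (by fun_prop),
    integral_map hg (by fun_prop)]
  have hint : ∀ h : Lp ℝ 2 P, Integrable (fun ω => Complex.exp (t * (h ω : ℝ) * Complex.I)) P := by
    intro h
    refine Integrable.of_bound (C := 1) ?_ ?_
    · have : AEMeasurable h P := (Lp.aestronglyMeasurable h).aemeasurable
      exact (by fun_prop : AEMeasurable _ P).aestronglyMeasurable
    · refine Eventually.of_forall fun ω => ?_
      have := Complex.norm_exp_ofReal_mul_I (t * h ω)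
      push_cast at this
      exact this.le
  rw [← integral_sub (hint f) (hint g)]
  have h1 : Integrable (fun ω => |(f - g : Lp ℝ 2 P) ω|) P :=
    ((Lp.memLp (f - g)).integrable (by norm_num)).abs
  have h2 : ∫ ω, |(f - g : Lp ℝ 2 P) ω| ∂P ≤ ‖f - g‖ := by
    have := eLpNorm_le_eLpNorm_of_exponent_le (μ := P) (p := 1) (q := 2) (by norm_num)
      (Lp.aestronglyMeasurable (f - g))
    rw [Lp.norm_def]
    rw [eLpNorm_one_eq_lintegral_enorm] at this
    have h3 := ENNReal.toReal_mono (Lp.eLpNorm_ne_top (f - g)) this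
    refine le_trans (le_of_eq ?_) h3
    rw [← integral_norm_eq_lintegral_enorm (Lp.aestronglyMeasurable (f - g))]
    simp [Real.norm_eq_abs]
  calc _ ≤ ∫ ω, |t| * |(f - g : Lp ℝ 2 P) ω| ∂P := by
        refine norm_integral_le_of_norm_le (h1.const_mul _) ?_
        filter_upwards [Lp.coeFn_sub f g] with ω hω
        rw [hω]
        have h := Real.norm_exp_I_mul_ofReal_sub_one_le (x := t * (f ω - g ω))
        have e : Complex.exp (t * (f ω : ℝ) * Complex.I) - Complex.exp (t * (g ω : ℝ) * Complex.I)
            = Complex.exp ((t * g ω : ℝ) * Complex.I) *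
              (Complex.exp (Complex.I * ((t * (f ω - g ω) : ℝ))) - 1) := by
          rw [mul_sub, ← Complex.exp_add, mul_one]
          congr 2 <;> push_cast <;> ring
        rw [e, norm_mul, Complex.norm_exp_ofReal_mul_I, one_mul]
        simpa [abs_mul] using h
    _ = |t| * ∫ ω, |(f - g : Lp ℝ 2 P) ω| ∂P := integral_const_mul _ _
    _ ≤ _ := by gcongr

theorem exists_isonormal (H : Type) [NormedAddCommGroup H] [InnerProductSpace ℝ H]
    [CompleteSpace H] :
    ∃ (Ω : Type) (_ : MeasurableSpace Ω) (P : Measure Ω), IsProbabilityMeasure P ∧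
      ∃ W : H →ₗᵢ[ℝ] Lp ℝ 2 P, ∀ f, P.map (W f) = gaussianReal 0 (‖f‖₊ ^ 2) := by
  obtain ⟨w, b, -⟩ := exists_hilbertBasis ℝ H
  obtain ⟨Ω, mΩ, P, X, hX, hlaw, hind, hP⟩ := exists_iid w (gaussianReal 0 1)
  refine ⟨Ω, mΩ, P, hP, ?_⟩
  have hG : ∀ i, HasGaussianLaw (X i) P := fun i => (hlaw i).hasGaussianLaw
  have hmean : ∀ i, ∫ ω, X i ω ∂P = 0 := by
    intro i; rw [(hlaw i).integral_eq, integral_id_gaussianReal]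
  have hvar : ∀ i, ∫ ω, X i ω * X i ω ∂P = 1 := by
    intro i
    have := (hlaw i).variance_eq
    rw [variance_id_gaussianReal, variance_of_integral_eq_zero (hX i).aemeasurable (hmean i)] at this
    simpa [sq] using this
  have hmem : ∀ i, MemLp (X i) 2 P := fun i => (hG i).memLp_two
  let v : w → Lp ℝ 2 P := fun i => (hmem i).toLp
  have hinner : ∀ i j, inner ℝ (v i) (v j) = ∫ ω, X i ω * X j ω ∂P := by
    intro i j
    rw [L2.inner_def]
    refine integral_congr_ae ?_
    filter_upwards [(hmem i).coeFn_toLp, (hmem j).coeFn_toLp] with ω h1 h2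
    simp only [v, h1, h2]
    simp [mul_comm]
  have hv : Orthonormal ℝ v := by
    classical
    rw [orthonormal_iff_ite]
    intro i j
    rw [hinner]
    split_ifs with h
    · subst h; exact hvar i
    · have := (hind.indepFun h).integral_mul_eq_mul_integral (hX i).aestronglyMeasurable
        (hX j).aestronglyMeasurable
      rw [hmean, zero_mul] at this
      exact this
  let W : H →ₗᵢ[ℝ] Lp ℝ 2 P :=
    (hv.orthogonalFamily.linearIsometry).comp b.repr.toLinearIsometry
  have hW : ∀ i, W (b i) = v i := by
    intro i
    classical
    have h1 : W (b i) = hv.orthogonalFamily.linearIsometry (b.repr (b i)) := rfl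
    rw [h1, b.repr_self, hv.orthogonalFamily.linearIsometry_apply_single]
    simp
  refine ⟨W, ?_⟩
  -- finite sums
  have hfin : ∀ (s : Finset w) (c : w → ℝ) (t : ℝ), charFun (P.map (W (∑ i ∈ s, c i • b i))) t
      = Complex.exp (-(t ^ 2 * ‖∑ i ∈ s, c i • b i‖ ^ 2 : ℝ) / 2) := by
    intro s c t
    have e1 : (W (∑ i ∈ s, c i • b i) : Ω → ℝ) =ᵐ[P] fun ω => ∑ i : s, c i * X i ω := by
      rw [map_sum]
      have h0 := Lp.coeFn_finsetSum s (fun i => W (c i • b i))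
      have h1 : ∀ᵐ ω ∂P, ∀ i ∈ s, W (c i • b i) ω = c i * X i ω := by
        rw [Filter.eventually_all_finset]
        intro i _
        rw [map_smul, hW]
        filter_upwards [Lp.coeFn_smul (c i) (v i), (hmem i).coeFn_toLp] with ω h1 h2
        rw [h1, Pi.smul_apply, smul_eq_mul, h2]
      filter_upwards [h0, h1] with ω h2 h3
      rw [h2, Finset.sum_apply, Finset.sum_coe_sort s (fun i => c i * X i ω)]
      exact Finset.sum_congr rfl h3
    have hg : HasGaussianLaw (fun ω => ∑ i : s, c i * X i ω) P := by
      have hi : iIndepFun (fun (i : s) ω => c i * X i ω) P := by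
        have := (hind.precomp (g := fun i : s => (i : w)) Subtype.val_injective)
        exact this.comp (fun i x => c i * x) (fun i => by fun_prop)
      refine iIndepFun.hasGaussianLaw_fun_sum (fun i => ?_) hi
      simpa using (hG i).fun_smul (c i)
    have hg' : HasGaussianLaw (W (∑ i ∈ s, c i • b i)) P := hg.congr e1.symm
    have hm : ∫ ω, W (∑ i ∈ s, c i • b i) ω ∂P = 0 := by
      rw [integral_congr_ae e1, integral_finsetSum]
      · refine Finset.sum_eq_zero fun i _ => ?_
        rw [integral_const_mul, hmean, mul_zero]
      · intro i _
        exact (hG i).integrable.const_mul _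
    have hvv : Var[W (∑ i ∈ s, c i • b i); P] = ‖∑ i ∈ s, c i • b i‖ ^ 2 := by
      rw [variance_of_integral_eq_zero hg'.aemeasurable hm, ← W.norm_map, ← real_inner_self_eq_norm_sq,
        L2.inner_def]
      simp [sq]
    rw [hg'.map_eq_gaussianReal, hm, hvv, charFun_gaussianReal]
    congr 1
    rw [Real.coe_toNNReal _ (by positivity)]
    push_cast
    ring
  intro f
  refine Measure.ext_of_charFun (funext fun t => ?_)
  have hs := b.hasSum_repr f
  have h1 : Tendsto (fun s : Finset w => charFun (P.map (W (∑ i ∈ s, b.repr f i • b i))) t) atTop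
      (𝓝 (charFun (P.map (W f)) t)) := by
    rw [tendsto_iff_norm_sub_tendsto_zero]
    have h2 : Tendsto (fun s : Finset w => |t| * ‖W (∑ i ∈ s, b.repr f i • b i) - W f‖) atTop
      (𝓝 0) := by
      have h3 : Tendsto (fun s : Finset w => W (∑ i ∈ s, b.repr f i • b i)) atTop (𝓝 (W f)) :=
        (W.continuous.tendsto f).comp hs
      rw [tendsto_iff_norm_sub_tendsto_zero] at h3
      simpa using h3.const_mul |t|
    exact squeeze_zero (fun _ => norm_nonneg _) (fun s => charFun_map_dist_le _ _ t) h2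
  have h2 : Tendsto (fun s : Finset w => charFun (P.map (W (∑ i ∈ s, b.repr f i • b i))) t) atTop
      (𝓝 (Complex.exp (-(t ^ 2 * ‖f‖ ^ 2 : ℝ) / 2))) := by
    simp_rw [hfin]
    have hc : Continuous fun g : H => Complex.exp (-(t ^ 2 * ‖g‖ ^ 2 : ℝ) / 2) := by fun_prop
    exact (hc.tendsto f).comp hs
  rw [tendsto_nhds_unique h1 h2, charFun_gaussianReal]
  congr 1
  push_cast
  ring

section isonormal

theorem isonormal_inner {H Ω : Type} [NormedAddCommGroup H] [InnerProductSpace ℝ H]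
    [MeasurableSpace Ω] {P : Measure Ω} (W : H →ₗᵢ[ℝ] Lp ℝ 2 P) (f g : H) :
    ∫ ω, W f ω * W g ω ∂P = inner ℝ f g := by
  rw [← W.inner_map_map, L2.inner_def]
  simp [mul_comm]

theorem isonormal_aemeas {H Ω : Type} [NormedAddCommGroup H] [InnerProductSpace ℝ H]
    [MeasurableSpace Ω] {P : Measure Ω} (W : H →ₗᵢ[ℝ] Lp ℝ 2 P) (f : H) :
    AEMeasurable (W f) P := (Lp.aestronglyMeasurable (W f)).aemeasurable

theorem isonormal_linComb {H Ω : Type} [NormedAddCommGroup H] [InnerProductSpace ℝ H]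
    [MeasurableSpace Ω] {P : Measure Ω} (W : H →ₗᵢ[ℝ] Lp ℝ 2 P) {ι : Type*} (s : Finset ι)
    (c : ι → ℝ) (f : ι → H) :
    (W (∑ i ∈ s, c i • f i) : Ω → ℝ) =ᵐ[P] fun ω => ∑ i ∈ s, c i * W (f i) ω := by
  rw [map_sum]
  have h0 := Lp.coeFn_finsetSum s (fun i => W (c i • f i))
  have h1 : ∀ᵐ ω ∂P, ∀ i ∈ s, W (c i • f i) ω = c i * W (f i) ω := by
    rw [Filter.eventually_all_finset]
    intro i _
    rw [map_smul]
    filter_upwards [Lp.coeFn_smul (c i) (W (f i))] with ω h1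
    rw [h1, Pi.smul_apply, smul_eq_mul]
  filter_upwards [h0, h1] with ω h2 h3
  rw [h2, Finset.sum_apply]
  exact Finset.sum_congr rfl h3

theorem isonormal_gaussianProcess {H Ω : Type} [NormedAddCommGroup H] [InnerProductSpace ℝ H]
    [MeasurableSpace Ω] {P : Measure Ω} [IsProbabilityMeasure P] (W : H →ₗᵢ[ℝ] Lp ℝ 2 P)
    (hW : ∀ f, P.map (W f) = gaussianReal 0 (‖f‖₊ ^ 2)) :
    IsGaussianProcess (fun f : H => (W f : Ω → ℝ)) P := by
  constructor
  intro I
  have hm : AEMeasurable (fun ω => I.restrict (fun f => W f ω)) P := by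
    refine aemeasurable_pi_lambda _ fun i => isonormal_aemeas W i
  constructor
  constructor
  intro L
  classical
  let c : I → ℝ := fun i => L (Pi.single i 1)
  have hL : ∀ x : I → ℝ, L x = ∑ i, c i * x i := by
    intro x
    have : x = ∑ i, x i • (Pi.single i 1 : I → ℝ) := by
      ext j; simp [Finset.sum_apply, Pi.single_apply]
    conv_lhs => rw [this]
    rw [map_sum]
    simp [c, mul_comm]
  have hae : (fun ω => L (I.restrict (fun f => W f ω))) =ᵐ[P]
      (W (∑ i : I, c i • (i : H)) : Ω → ℝ) := by
    filter_upwards [isonormal_linComb W Finset.univ c (fun i : I => (i : H))] with ω h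
    rw [h, hL]
    rfl
  have hG : (P.map (fun ω => I.restrict (fun f => W f ω))).map L
      = gaussianReal 0 (‖∑ i : I, c i • (i : H)‖₊ ^ 2) := by
    rw [AEMeasurable.map_map_of_aemeasurable (by fun_prop) hm, ← hW]
    exact Measure.map_congr hae
  have hG2 : HasLaw L (gaussianReal 0 (‖∑ i : I, c i • (i : H)‖₊ ^ 2))
      (P.map (fun ω => I.restrict (fun f => W f ω))) := ⟨by fun_prop, hG⟩
  rw [hG, hG2.integral_eq, hG2.variance_eq]
  rw [integral_id_gaussianReal, variance_id_gaussianReal, Real.toNNReal_coe]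

theorem gaussianReal_Icc_le {v : NNReal} {σ δ : ℝ} (hσ : 0 < σ) (hv : σ ^ 2 ≤ v) (hδ : 0 ≤ δ) (c : ℝ) :
    gaussianReal 0 v (Icc (c - δ) (c + δ)) ≤ ENNReal.ofReal (δ / σ) := by
  have hv0 : v ≠ 0 := by
    rintro rfl
    have : 0 < σ ^ 2 := by positivity
    simp at hv; linarith
  rw [gaussianReal_apply _ hv0]
  have hb : ∀ x, gaussianPDF 0 v x ≤ ENNReal.ofReal (1 / (2 * σ)) := by
    intro x
    rw [gaussianPDF]
    apply ENNReal.ofReal_le_ofReal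
    rw [gaussianPDFReal]
    have h1 : Real.exp (-(x - 0) ^ 2 / (2 * v)) ≤ 1 := by
      apply Real.exp_le_one_iff.2
      apply div_nonpos_of_nonpos_of_nonneg
      · nlinarith [sq_nonneg (x - 0)]
      · positivity
    have h2 : 2 * σ ≤ √(2 * Real.pi * v) := by
      apply Real.le_sqrt_of_sq_le
      have := Real.pi_gt_three
      nlinarith [sq_nonneg σ]
    calc _ ≤ (√(2 * Real.pi * v))⁻¹ * 1 := by gcongr
      _ ≤ _ := by rw [mul_one, one_div]; gcongr
  calc _ ≤ ∫⁻ x in Icc (c - δ) (c + δ), ENNReal.ofReal (1 / (2 * σ)) := lintegral_mono fun x => hb x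
    _ = ENNReal.ofReal (δ / σ) := by
      rw [setLIntegral_const, Real.volume_Icc, ← ENNReal.ofReal_mul (by positivity)]
      congr 1; field_simp; ring

theorem smallball_step {Ω β : Type*} [MeasurableSpace Ω] [MeasurableSpace β] {P : Measure Ω}
    [IsProbabilityMeasure P] {Z : Ω → ℝ} {Y : Ω → β} (hind : IndepFun Z Y P)
    (hZm : AEMeasurable Z P) (hYm : AEMeasurable Y P) {δ : ℝ} {q : ENNReal}
    (hZ : ∀ c, P.map Z (Icc (c - δ) (c + δ)) ≤ q) {A : Set β} (hA : MeasurableSet A) {φ : β → ℝ}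
    (hφ : Measurable φ) :
    P {ω | Y ω ∈ A ∧ |Z ω + φ (Y ω)| ≤ δ} ≤ q * P {ω | Y ω ∈ A} := by
  have hS : MeasurableSet {p : ℝ × β | p.2 ∈ A ∧ |p.1 + φ p.2| ≤ δ} := by
    refine MeasurableSet.inter (measurable_snd hA) ?_
    exact measurableSet_le (f := fun p : ℝ × β => |p.1 + φ p.2|) (g := fun _ => δ)
      (measurable_fst.add (hφ.comp measurable_snd)).abs measurable_const
  have h1 : P {ω | Y ω ∈ A ∧ |Z ω + φ (Y ω)| ≤ δ}
      = P.map (fun ω => (Z ω, Y ω)) {p : ℝ × β | p.2 ∈ A ∧ |p.1 + φ p.2| ≤ δ} := by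
    rw [Measure.map_apply_of_aemeasurable (hZm.prodMk hYm) hS]; rfl
  have := Measure.isProbabilityMeasure_map hZm
  have := Measure.isProbabilityMeasure_map hYm
  rw [h1, (indepFun_iff_map_prod_eq_prod_map_map hZm hYm).1 hind, Measure.prod_apply_symm hS]
  have h2 : P {ω | Y ω ∈ A} = ∫⁻ y, A.indicator 1 y ∂(P.map Y) := by
    rw [lintegral_indicator_one hA, Measure.map_apply_of_aemeasurable hYm hA]; rfl
  rw [h2, ← lintegral_const_mul _ (measurable_one.indicator hA)]
  refine lintegral_mono fun y => ?_
  by_cases hy : y ∈ A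
  · simp only [Set.indicator_of_mem hy, Pi.one_apply, mul_one]
    refine le_trans (measure_mono ?_) (hZ (-φ y))
    intro z hz
    have := abs_le.1 hz.2
    simp only at this
    constructor <;> linarith
  · have : (fun x => (x, y)) ⁻¹' {p : ℝ × β | p.2 ∈ A ∧ |p.1 + φ p.2| ≤ δ} = ∅ := by
      ext z; simp [hy]
    simp [this, hy]

theorem isonormal_smallball {H Ω : Type} [NormedAddCommGroup H] [InnerProductSpace ℝ H]
    [MeasurableSpace Ω] {P : Measure Ω} [IsProbabilityMeasure P] (W : H →ₗᵢ[ℝ] Lp ℝ 2 P)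
    (hW : ∀ f, P.map (W f) = gaussianReal 0 (‖f‖₊ ^ 2)) (f g : ℕ → H) {σ δ : ℝ} (hσ : 0 < σ)
    (hδ : 0 ≤ δ)
    (hg : ∀ i, σ ≤ ‖g i‖) (hfg : ∀ i j, j < i → inner ℝ (g i) (f j) = 0)
    (hfg' : ∀ i, inner ℝ (g i) (f i - g i) = 0) (N : ℕ) :
    P {ω | ∀ i < N, |W (f i) ω| ≤ δ} ≤ ENNReal.ofReal (δ / σ) ^ N := by
  induction N with
  | zero => simp
  | succ N ih =>
    let K : Type := {h : H // inner ℝ (g N) h = 0}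
    have hGP := isonormal_gaussianProcess W hW
    have hmean : ∀ h, ∫ ω, W h ω ∂P = 0 := by
      intro h
      have : HasLaw (W h) (gaussianReal 0 (‖h‖₊ ^ 2)) P := ⟨isonormal_aemeas W h, hW h⟩
      rw [this.integral_eq, integral_id_gaussianReal]
    have hind : IndepFun (fun ω (_ : Unit) => W (g N) ω) (fun ω (h : K) => W h.1 ω) P := by
      refine IsGaussianProcess.indepFun_of_covariance_eq_zero (X := fun (_ : Unit) => W (g N))
        (Y := fun h : K => W h.1) ?_ (fun _ => isonormal_aemeas W _)
        (fun _ => isonormal_aemeas W _) ?_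
      · have := hGP.comp_right (Sum.elim (fun _ : Unit => g N) (fun h : K => h.1))
        have e : (Sum.elim (fun (_ : Unit) => (W (g N) : Ω → ℝ)) fun h : K => (W h.1 : Ω → ℝ)) =
            (fun f : H => (W f : Ω → ℝ)) ∘ Sum.elim (fun _ : Unit => g N) (fun h : K => h.1) := by
          funext x
          cases x <;> rfl
        rw [e]
        exact this
      · intro _ h
        rw [covariance_eq_sub (hGP.hasGaussianLaw_eval _).memLp_two
          (hGP.hasGaussianLaw_eval h.1).memLp_two, hmean, zero_mul, sub_zero]
        exact (isonormal_inner W _ _).trans h.2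
    have hZ : IndepFun (W (g N) : Ω → ℝ) (fun ω (h : K) => W h.1 ω) P := hind.comp (φ := fun z : Unit → ℝ => z ()) (ψ := id)
      (measurable_pi_apply ()) measurable_id
    have hYm : AEMeasurable (fun ω (h : K) => W h.1 ω) P := by
      have : ∀ h : H, Measurable (W h) := fun h => (Lp.stronglyMeasurable (W h)).measurable
      exact (measurable_pi_lambda _ fun h : K => this h.1).aemeasurable
    let A : Set (K → ℝ) := ⋂ j : Fin N, {y | |y ⟨f j, hfg N j j.2⟩| ≤ δ}
    have hA : MeasurableSet A := by
      refine MeasurableSet.iInter fun j => measurableSet_le ?_ measurable_const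
      exact (measurable_pi_apply _).abs
    have := smallball_step (q := ENNReal.ofReal (δ / σ)) (δ := δ) hZ (isonormal_aemeas W _) hYm ?_ hA
      (φ := fun y => y ⟨f N - g N, hfg' N⟩) (measurable_pi_apply _)
    · calc P {ω | ∀ i < N + 1, |W (f i) ω| ≤ δ} ≤ _ := by
            refine measure_mono_ae ?_
            have hsub := Lp.coeFn_sub (W (f N)) (W (g N))
            rw [← map_sub] at hsub
            filter_upwards [hsub] with ω h1 h2
            have h3 : ∀ i < N + 1, |W (f i) ω| ≤ δ := h2
            refine ⟨?_, ?_⟩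
            · simp only [A, Set.mem_iInter, Set.mem_ofPred_eq]
              intro j
              exact h3 j (by omega)
            · rw [h1]
              simpa using h3 N (by omega)
        _ ≤ _ := this
        _ ≤ ENNReal.ofReal (δ / σ) * ENNReal.ofReal (δ / σ) ^ N := by
            gcongr
            refine le_trans (measure_mono ?_) ih
            intro ω hω i hi
            have hω' : (fun h : K => W h.1 ω) ∈ A := hω
            simp only [A, Set.mem_iInter, Set.mem_ofPred_eq] at hω'
            exact hω' ⟨i, hi⟩
        _ = _ := (pow_succ' _ _).symm
    · intro c
      rw [hW]
      refine gaussianReal_Icc_le hσ ?_ hδ c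
      push_cast
      exact pow_le_pow_left₀ hσ.le (hg N) 2

theorem isonormal_tail {H Ω : Type} [NormedAddCommGroup H] [InnerProductSpace ℝ H]
    [MeasurableSpace Ω] {P : Measure Ω} [IsProbabilityMeasure P] (W : H →ₗᵢ[ℝ] Lp ℝ 2 P)
    (hW : ∀ f, P.map (W f) = gaussianReal 0 (‖f‖₊ ^ 2)) (m : ℕ) :
    ∃ C : ℝ, 0 ≤ C ∧ ∀ (f : H) (σ lam : ℝ), 0 < σ → 0 < lam → ‖f‖ ≤ σ →
      P {ω | lam * σ < |W f ω|} ≤ ENNReal.ofReal (C / lam ^ m) := by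
  refine ⟨∫ x, |x| ^ m ∂(gaussianReal 0 1), by positivity, fun f σ lam hσ hlam hf => ?_⟩
  have hlaw : gaussianReal 0 (‖f‖₊ ^ 2) = (gaussianReal 0 1).map (fun x => ‖f‖ * x) := by
    rw [gaussianReal_map_const_mul]
    congr 1
    · simp
    · ext; simp
  have hS : MeasurableSet {x : ℝ | lam * σ < |x|} := measurableSet_lt (by fun_prop) (by fun_prop)
  have h1 : P {ω | lam * σ < |W f ω|} = (gaussianReal 0 1) {x : ℝ | lam * σ < |‖f‖ * x|} := by
    have e : P {ω | lam * σ < |W f ω|} = P.map (W f) {x : ℝ | lam * σ < |x|} := by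
      rw [Measure.map_apply_of_aemeasurable (isonormal_aemeas W f) hS]; rfl
    rw [e, hW, hlaw, Measure.map_apply (by fun_prop) hS]; rfl
  have h2 : (gaussianReal 0 1) {x : ℝ | lam * σ < |‖f‖ * x|}
      ≤ (gaussianReal 0 1) {x : ℝ | lam ^ m ≤ |x| ^ m} := by
    refine measure_mono fun x hx => ?_
    simp only [Set.mem_ofPred_eq, abs_mul, abs_norm] at hx ⊢
    refine pow_le_pow_left₀ hlam.le ?_ m
    by_contra! hlt
    have : ‖f‖ * |x| ≤ σ * lam := by gcongr
    linarith [mul_comm σ lam]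
  have hint : Integrable (fun x : ℝ => |x| ^ m) (gaussianReal 0 1) := by
    have := (memLp_id_gaussianReal (μ := 0) (v := 1) (m : NNReal)).integrable_norm_pow'
    simpa using this
  have h3 := mul_meas_ge_le_integral_of_nonneg (μ := gaussianReal 0 1)
    (Eventually.of_forall fun x : ℝ => by positivity) hint (lam ^ m)
  rw [h1]
  refine h2.trans ?_
  rw [← ofReal_measureReal (by simp)]
  apply ENNReal.ofReal_le_ofReal
  rw [le_div_iff₀ (by positivity)]
  linarith

end isonormal

section kernelEstimates

theorem rpow_sub_rpow_exponent_le {c T u e e' : ℝ} (hc : 0 < c) (hT : 1 ≤ T) (hu : 0 < u)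
    (huT : u ≤ T) (he : e ∈ Icc c 1) (he' : e' ∈ Icc c 1) :
    |u ^ e - u ^ e'| ≤ (1 / c + T ^ 2) * |e - e'| := by
  have key : ∀ x ∈ Icc c 1, ‖u ^ x * Real.log u‖ ≤ 1 / c + T ^ 2 := by
    intro x hx
    rw [Real.norm_eq_abs]
    rcases le_total u 1 with h1 | h1
    · have h2 := Real.abs_log_mul_self_rpow_lt u x hu h1 (hc.trans_le hx.1)
      rw [mul_comm]
      have h3 : 1 / x ≤ 1 / c := one_div_le_one_div_of_le hc hx.1
      nlinarith [sq_nonneg T]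
    · have h2 : u ^ x ≤ T := by
        calc u ^ x ≤ u ^ (1:ℝ) := Real.rpow_le_rpow_of_exponent_le h1 hx.2
          _ ≤ T := by simpa using huT
      have h3 : Real.log u ≤ T := (Real.log_le_self hu.le).trans huT
      have h4 : 0 ≤ Real.log u := Real.log_nonneg h1
      rw [abs_of_nonneg (by positivity)]
      have : u ^ x * Real.log u ≤ T * T := by gcongr
      have : 0 < 1 / c := by positivity
      nlinarith
  have := Convex.norm_image_sub_le_of_norm_hasDerivWithin_le (𝕜 := ℝ) (f := fun x : ℝ => u ^ x)
    (f' := fun x => u ^ x * Real.log u) (s := Icc c 1) (C := 1 / c + T ^ 2)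
    (fun x _ => (Real.hasStrictDerivAt_const_rpow hu x).hasDerivAt.hasDerivWithinAt) key
    (convex_Icc c 1) he' he
  simpa [Real.norm_eq_abs] using this

theorem near_bound {a b u θ : ℝ} (ha : 0 < a) (hb : b < 1) (hu : 0 < u) (hu2 : u ≤ 2)
    (hθ : θ ∈ Icc a b) : u ^ (θ - 1/2) ≤ 2 * u ^ (a / 2 - 1/2) := by
  have h1 : u ^ (θ - 1/2) = u ^ (θ - a/2) * u ^ (a/2 - 1/2) := by
    rw [← Real.rpow_add hu]; congr 1; ring
  rw [h1]
  gcongr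
  have h0 : 0 ≤ θ - a / 2 := by linarith [hθ.1]
  calc u ^ (θ - a/2) ≤ 2 ^ (θ - a/2) := Real.rpow_le_rpow hu.le hu2 h0
    _ ≤ 2 ^ (1:ℝ) := Real.rpow_le_rpow_of_exponent_le (by norm_num) (by linarith [hθ.2])
    _ = 2 := by norm_num

theorem near_bound_sub {a b u θ θ' : ℝ} (ha : 0 < a) (hb : b < 1) (hu : 0 < u) (hu2 : u ≤ 2)
    (hθ : θ ∈ Icc a b) (hθ' : θ' ∈ Icc a b) :
    |u ^ (θ - 1/2) - u ^ (θ' - 1/2)| ≤ (2 / a + 4) * |θ - θ'| * u ^ (a / 2 - 1/2) := by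
  have h1 : ∀ θ, u ^ (θ - 1/2) = u ^ (θ - a/2) * u ^ (a/2 - 1/2) := by
    intro θ
    rw [← Real.rpow_add hu]; congr 1; ring
  rw [h1 θ, h1 θ', ← sub_mul, abs_mul, abs_of_nonneg (Real.rpow_nonneg hu.le (a / 2 - 1 / 2))]
  gcongr
  have := rpow_sub_rpow_exponent_le (c := a / 2) (T := 2) (e := θ - a/2) (e' := θ' - a/2)
    (by positivity) (by norm_num) hu hu2 ⟨by linarith [hθ.1], by linarith [hθ.2]⟩
    ⟨by linarith [hθ'.1], by linarith [hθ'.2]⟩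
  have e : θ - a/2 - (θ' - a/2) = θ - θ' := by ring
  rw [e] at this
  have e2 : 1 / (a/2) + 2^2 = 2 / a + 4 := by field_simp; ring
  rwa [e2] at this

theorem far_bound {a b y θ : ℝ} (ha : 0 < a) (hb : b < 1) (hy : 1 ≤ y)
    (hθ : θ ∈ Icc a b) : |(1 + y) ^ (θ - 1/2) - y ^ (θ - 1/2)| ≤ y ^ (b / 2 - 1) := by
  have key : ∀ v ∈ Icc y (1 + y), ‖(θ - 1/2) * v ^ (θ - 1/2 - 1)‖ ≤ y ^ (b / 2 - 1) := by
    intro v hv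
    have hv0 : 1 ≤ v := hy.trans hv.1
    rw [Real.norm_eq_abs, abs_mul, abs_of_nonneg (Real.rpow_nonneg (by linarith) (θ - 1/2 - 1))]
    have h1 : |θ - 1/2| ≤ 1 := abs_le.2 ⟨by linarith [hθ.1], by linarith [hθ.2]⟩
    calc |θ - 1/2| * v ^ (θ - 1/2 - 1) ≤ 1 * v ^ (b/2 - 1) := by
          have h2 : v ^ (θ - 1/2 - 1) ≤ v ^ (b/2 - 1) :=
            Real.rpow_le_rpow_of_exponent_le hv0 (by linarith [hθ.2])
          exact mul_le_mul h1 h2 (Real.rpow_nonneg (by linarith) _) zero_le_one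
      _ ≤ y ^ (b/2 - 1) := by
          rw [one_mul]
          exact Real.rpow_le_rpow_of_nonpos (by linarith) hv.1 (by linarith)
  have := Convex.norm_image_sub_le_of_norm_hasDerivWithin_le (𝕜 := ℝ)
    (f := fun v : ℝ => v ^ (θ - 1/2)) (f' := fun v => (θ - 1/2) * v ^ (θ - 1/2 - 1))
    (s := Icc y (1 + y)) (C := y ^ (b / 2 - 1))
    (fun v hv => (Real.hasDerivAt_rpow_const (Or.inl (by linarith [hv.1]))).hasDerivWithinAt) key
    (convex_Icc _ _) (x := y) (y := 1 + y) ⟨le_rfl, by linarith⟩ ⟨by linarith, le_rfl⟩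
  simpa [Real.norm_eq_abs] using this

theorem far_bound_sub {a b y θ θ' : ℝ} (ha : 0 < a) (hb : b < 1) (hy : 1 ≤ y)
    (hθ : θ ∈ Icc a b) (hθ' : θ' ∈ Icc a b) :
    |((1 + y) ^ (θ - 1/2) - y ^ (θ - 1/2)) - ((1 + y) ^ (θ' - 1/2) - y ^ (θ' - 1/2))|
      ≤ (1 + 2 / (1 - b)) * y ^ (b / 2 - 1) * |θ - θ'| := by
  have hy0 : 0 < y := by linarith
  have key : ∀ x ∈ Icc a b, ‖(1 + y) ^ (x - 1/2) * Real.log (1 + y) - y ^ (x - 1/2) * Real.log y‖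
      ≤ (1 + 2 / (1 - b)) * y ^ (b / 2 - 1) := by
    intro x hx
    have key2 : ∀ v ∈ Icc y (1 + y), ‖((x - 1/2) * v ^ (x - 1/2 - 1)) * Real.log v
        + v ^ (x - 1/2) * v⁻¹‖ ≤ (1 + 2 / (1 - b)) * y ^ (b / 2 - 1) := by
      intro v hv
      have hv1 : 1 ≤ v := hy.trans hv.1
      have hv0 : 0 < v := by linarith
      have e : ((x - 1/2) * v ^ (x - 1/2 - 1)) * Real.log v + v ^ (x - 1/2) * v⁻¹
          = v ^ (x - 1/2 - 1) * ((x - 1/2) * Real.log v + 1) := by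
        rw [Real.rpow_sub_one hv0.ne']; field_simp
      have hl : 0 ≤ Real.log v := Real.log_nonneg hv1
      have hη : 0 < (1 - b) / 2 := by linarith
      have h1 : |(x - 1/2) * Real.log v + 1| ≤ (1 + 2 / (1 - b)) * v ^ ((1 - b) / 2) := by
        have h2 := Real.log_le_rpow_div hv0.le hη
        have h3 : 1 ≤ v ^ ((1 - b) / 2) := Real.one_le_rpow hv1 hη.le
        have h4 : |x - 1/2| ≤ 1 := abs_le.2 ⟨by linarith [hx.1], by linarith [hx.2]⟩
        calc _ ≤ |(x - 1/2) * Real.log v| + |1| := abs_add_le _ _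
          _ = |x - 1/2| * Real.log v + 1 := by rw [abs_mul, abs_of_nonneg hl, abs_one]
          _ ≤ 1 * (v ^ ((1 - b) / 2) / ((1 - b) / 2)) + v ^ ((1 - b) / 2) := by gcongr
          _ = _ := by field_simp; ring
      rw [e, Real.norm_eq_abs, abs_mul, abs_of_nonneg (Real.rpow_nonneg hv0.le (x - 1/2 - 1))]
      have hC : 0 ≤ 1 + 2 / (1 - b) := by
        have : 0 < 1 - b := by linarith
        positivity
      calc _ ≤ v ^ (b - 3/2) * ((1 + 2 / (1 - b)) * v ^ ((1 - b) / 2)) := by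
            have h2 : v ^ (x - 1/2 - 1) ≤ v ^ (b - 3/2) :=
              Real.rpow_le_rpow_of_exponent_le hv1 (by linarith [hx.2])
            exact mul_le_mul h2 h1 (abs_nonneg _) (Real.rpow_nonneg hv0.le _)
        _ = (1 + 2 / (1 - b)) * v ^ (b/2 - 1) := by
            rw [mul_left_comm, ← Real.rpow_add hv0]
            congr 2; ring
        _ ≤ _ := mul_le_mul_of_nonneg_left
            (Real.rpow_le_rpow_of_nonpos hy0 hv.1 (by linarith)) hC
    have := Convex.norm_image_sub_le_of_norm_hasDerivWithin_le (𝕜 := ℝ)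
      (f := fun v : ℝ => v ^ (x - 1/2) * Real.log v)
      (f' := fun v => ((x - 1/2) * v ^ (x - 1/2 - 1)) * Real.log v + v ^ (x - 1/2) * v⁻¹)
      (s := Icc y (1 + y)) (C := (1 + 2 / (1 - b)) * y ^ (b / 2 - 1))
      (fun v hv => ((Real.hasDerivAt_rpow_const (Or.inl (by linarith [hv.1]))).mul
        (Real.hasDerivAt_log (by linarith [hv.1]))).hasDerivWithinAt) key2
      (convex_Icc _ _) (x := y) (y := 1 + y) ⟨le_rfl, by linarith⟩ ⟨by linarith, le_rfl⟩
    simpa using this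
  have hd : ∀ u : ℝ, 0 < u → ∀ x : ℝ, HasDerivAt (fun x : ℝ => u ^ (x - 1/2))
      (u ^ (x - 1/2) * Real.log u) x := by
    intro u hu x
    have := (Real.hasStrictDerivAt_const_rpow hu (x - 1/2)).hasDerivAt.comp x
      ((hasDerivAt_id x).sub_const (1/2))
    simpa [Function.comp_def] using this
  have := Convex.norm_image_sub_le_of_norm_hasDerivWithin_le (𝕜 := ℝ)
    (f := fun x : ℝ => (1 + y) ^ (x - 1/2) - y ^ (x - 1/2))
    (f' := fun x => (1 + y) ^ (x - 1/2) * Real.log (1 + y) - y ^ (x - 1/2) * Real.log y)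
    (s := Icc a b) (C := (1 + 2 / (1 - b)) * y ^ (b / 2 - 1))
    (fun x _ => ((hd (1 + y) (by linarith) x).sub (hd y hy0 x)).hasDerivWithinAt) key
    (convex_Icc _ _) hθ' hθ
  simpa [Real.norm_eq_abs] using this

/-- Near-singularity profile. -/
def nearProf (p u : ℝ) : ℝ := (Ioc (0:ℝ) 2).indicator (fun u => u ^ p) u

/-- Tail profile. -/
def farProf (r u : ℝ) : ℝ := (Ioi (1:ℝ)).indicator (fun u => u ^ r) u

theorem nearProf_nonneg (p u : ℝ) : 0 ≤ nearProf p u :=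
  Set.indicator_nonneg (fun _ hx => Real.rpow_nonneg (le_of_lt hx.1) _) _

theorem farProf_nonneg (p u : ℝ) : 0 ≤ farProf p u :=
  Set.indicator_nonneg (fun x hx => Real.rpow_nonneg (by have : 1 < x := hx; linarith) _) _

theorem memLp_nearProf {p : ℝ} (hp : -1/2 < p) : MemLp (nearProf p) 2 (volume : Measure ℝ) := by
  unfold nearProf
  have hm : Measurable fun u : ℝ => u ^ p := by fun_prop
  change MemLp ((Ioc (0:ℝ) 2).indicator (fun u => u ^ p)) 2 volume
  rw [memLp_indicator_iff_restrict measurableSet_Ioc, memLp_two_iff_integrable_sq hm.aestronglyMeasurable]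
  have h := (intervalIntegral.intervalIntegrable_rpow' (a := 0) (b := 2) (r := 2 * p) (by linarith)).1
  refine IntegrableOn.congr_fun h (fun x hx => ?_) measurableSet_Ioc
  rw [← Real.rpow_natCast, ← Real.rpow_mul hx.1.le]
  congr 1; push_cast; ring

theorem memLp_farProf {r : ℝ} (hr : r < -1/2) : MemLp (farProf r) 2 (volume : Measure ℝ) := by
  have hm : Measurable fun u : ℝ => u ^ r := by fun_prop
  change MemLp ((Ioi (1:ℝ)).indicator (fun u => u ^ r)) 2 volume
  rw [memLp_indicator_iff_restrict measurableSet_Ioi, memLp_two_iff_integrable_sq hm.aestronglyMeasurable]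
  have h := integrableOn_Ioi_rpow_of_lt (a := 2 * r) (c := 1) (by linarith) (by norm_num)
  refine IntegrableOn.congr_fun h (fun x hx => ?_) measurableSet_Ioi
  have : 1 < x := hx
  rw [← Real.rpow_natCast, ← Real.rpow_mul (by linarith)]
  congr 1; push_cast; ring

theorem kernel_dominated {a b : ℝ} (ha : 0 < a) (hb : b < 1) :
    ∃ G : ℝ → ℝ, MemLp G 2 (volume : Measure ℝ) ∧ (∀ x, 0 ≤ G x) ∧
      (∀ θ ∈ Icc a b, ∀ x, |fbmKernel θ 1 x| ≤ G x) ∧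
      (∀ θ ∈ Icc a b, ∀ θ' ∈ Icc a b, ∀ x, |fbmKernel θ 1 x - fbmKernel θ' 1 x| ≤ |θ - θ'| * G x) := by
  let p := a / 2 - 1/2
  let r := b / 2 - 1
  let C := (2 / a + 4) + (1 + 2 / (1 - b)) 
  have hb' : 0 < 2 / (1 - b) := div_pos (by norm_num) (by linarith)
  have ha' : 0 < 2 / a := by positivity
  let G : ℝ → ℝ := fun x => C * (nearProf p (1 - x) + nearProf p (-x) + farProf r (-x))
  have hC1 : 2 / a + 4 ≤ C := by simp only [C]; linarith
  have hC2 : 1 + 2 / (1 - b) ≤ C := by simp only [C]; linarith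
  have hC3 : 2 ≤ C := by simp only [C]; linarith
  have hn : ∀ u, 0 ≤ nearProf p u := nearProf_nonneg p
  have hf : ∀ u, 0 ≤ farProf r u := farProf_nonneg r
  have hnear1 : ∀ θ ∈ Icc a b, ∀ u ≤ 2, |posRPow u (θ - 1/2)| ≤ C * nearProf p u := by
    intro θ hθ u hu
    unfold posRPow
    split_ifs with h0
    · rw [abs_of_nonneg (by positivity)]
      have : nearProf p u = u ^ p := Set.indicator_of_mem (show u ∈ Ioc (0:ℝ) 2 from ⟨h0, hu⟩) _
      rw [this]
      refine (near_bound ha hb h0 hu hθ).trans ?_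
      gcongr
    · rw [abs_zero]
      exact mul_nonneg (by linarith) (hn u)
  have hnear2 : ∀ θ ∈ Icc a b, ∀ θ' ∈ Icc a b, ∀ u ≤ 2,
      |posRPow u (θ - 1/2) - posRPow u (θ' - 1/2)| ≤ |θ - θ'| * (C * nearProf p u) := by
    intro θ hθ θ' hθ' u hu
    unfold posRPow
    split_ifs with h0
    · have : nearProf p u = u ^ p := Set.indicator_of_mem (show u ∈ Ioc (0:ℝ) 2 from ⟨h0, hu⟩) _
      rw [this]
      refine (near_bound_sub ha hb h0 hu hθ hθ').trans ?_
      rw [← mul_assoc, mul_comm |θ - θ'|]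
      gcongr
    · rw [sub_zero, abs_zero]
      have := hn u
      have : 0 ≤ C := by linarith
      positivity
  refine ⟨G, ?_, ?_, ?_, ?_⟩
  · have h1 : MemLp (fun x : ℝ => nearProf p (1 - x)) 2 volume :=
      (memLp_nearProf (by simp only [p]; linarith)).comp_measurePreserving
        (Measure.measurePreserving_sub_left volume (1:ℝ))
    have h2 : MemLp (fun x : ℝ => nearProf p (-x)) 2 volume :=
      (memLp_nearProf (by simp only [p]; linarith)).comp_measurePreserving
        (Measure.measurePreserving_neg volume)
    have h3 : MemLp (fun x : ℝ => farProf r (-x)) 2 volume :=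
      (memLp_farProf (by simp only [r]; linarith)).comp_measurePreserving
        (Measure.measurePreserving_neg volume)
    exact ((h1.add h2).add h3).const_mul C
  · intro x
    have := hn (1 - x); have := hn (-x); have := hf (-x)
    have : 0 ≤ C := by linarith
    positivity
  · intro θ hθ x
    have e : G x = C * nearProf p (1 - x) + C * nearProf p (-x) + C * farProf r (-x) := by
      simp only [G]; ring
    have h1 := mul_nonneg (show 0 ≤ C by linarith) (hn (1 - x))
    have h2 := mul_nonneg (show 0 ≤ C by linarith) (hn (-x))
    have h3 := mul_nonneg (show 0 ≤ C by linarith) (hf (-x))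
    rcases le_or_gt (-1) x with hx | hx
    · have h4 := hnear1 θ hθ (1 - x) (by linarith)
      have h5 := hnear1 θ hθ (-x) (by linarith)
      have h6 := abs_sub (posRPow (1 - x) (θ - 1/2)) (posRPow (-x) (θ - 1/2))
      rw [e]; unfold fbmKernel
      linarith
    · have h4 : farProf r (-x) = (-x) ^ r :=
        Set.indicator_of_mem (show -x ∈ Ioi (1:ℝ) from (by simp; linarith)) _
      have h5 := far_bound (y := -x) ha hb (by linarith) hθ
      unfold fbmKernel posRPow
      rw [if_pos (by linarith), if_pos (by linarith), sub_eq_add_neg 1 x]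
      have : (-x) ^ (b/2 - 1) ≤ C * farProf r (-x) := by
        rw [h4]
        have : 0 ≤ (-x) ^ r := Real.rpow_nonneg (by linarith) _
        change (-x) ^ r ≤ _
        nlinarith
      linarith
  · intro θ hθ θ' hθ' x
    have e : |θ - θ'| * G x = |θ - θ'| * (C * nearProf p (1 - x)) +
        |θ - θ'| * (C * nearProf p (-x)) + |θ - θ'| * (C * farProf r (-x)) := by
      simp only [G]; ring
    have h0 := abs_nonneg (θ - θ')
    have h1 := mul_nonneg h0 (mul_nonneg (show 0 ≤ C by linarith) (hn (1 - x)))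
    have h2 := mul_nonneg h0 (mul_nonneg (show 0 ≤ C by linarith) (hn (-x)))
    have h3 := mul_nonneg h0 (mul_nonneg (show 0 ≤ C by linarith) (hf (-x)))
    rcases le_or_gt (-1) x with hx | hx
    · have h4 := hnear2 θ hθ θ' hθ' (1 - x) (by linarith)
      have h5 := hnear2 θ hθ θ' hθ' (-x) (by linarith)
      have h6 := abs_sub (posRPow (1 - x) (θ - 1/2) - posRPow (1 - x) (θ' - 1/2))
        (posRPow (-x) (θ - 1/2) - posRPow (-x) (θ' - 1/2))
      rw [e]; unfold fbmKernel
      have e2 : posRPow (1 - x) (θ - 1/2) - posRPow (-x) (θ - 1/2) -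
        (posRPow (1 - x) (θ' - 1/2) - posRPow (-x) (θ' - 1/2)) =
        posRPow (1 - x) (θ - 1/2) - posRPow (1 - x) (θ' - 1/2) -
        (posRPow (-x) (θ - 1/2) - posRPow (-x) (θ' - 1/2)) := by ring
      rw [e2]
      linarith
    · have h4 : farProf r (-x) = (-x) ^ r :=
        Set.indicator_of_mem (show -x ∈ Ioi (1:ℝ) from (by simp; linarith)) _
      have h5 := far_bound_sub (y := -x) ha hb (by linarith) hθ hθ'
      unfold fbmKernel posRPow
      rw [if_pos (by linarith), if_pos (by linarith), if_pos (by linarith), if_pos (by linarith),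
        sub_eq_add_neg 1 x]
      have : (1 + 2 / (1 - b)) * (-x) ^ (b/2 - 1) * |θ - θ'| ≤ |θ - θ'| * (C * farProf r (-x)) := by
        rw [h4, mul_comm]
        have : 0 ≤ (-x) ^ r := Real.rpow_nonneg (by linarith) _
        change |θ - θ'| * (_ * (-x) ^ r) ≤ _
        gcongr
      linarith

end kernelEstimates

section kernelL2
theorem le_of_sq_le_sq0 {x y : ℝ} (h : x ^ 2 ≤ y ^ 2) (hy : 0 ≤ y) : x ≤ y :=
  le_of_abs_le (abs_of_nonneg hy ▸ sq_le_sq.1 h)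


theorem inner_toLp_eq {f g : ℝ → ℝ} (hf : MemLp f 2 (volume : Measure ℝ))
    (hg : MemLp g 2 (volume : Measure ℝ)) :
    inner ℝ (hf.toLp f) (hg.toLp g) = ∫ x, f x * g x := by
  rw [L2.inner_def]
  refine integral_congr_ae ?_
  filter_upwards [hf.coeFn_toLp, hg.coeFn_toLp] with x h1 h2
  rw [h1, h2]; simp [mul_comm]

theorem norm_toLp_sq {f : ℝ → ℝ} (hf : MemLp f 2 (volume : Measure ℝ)) :
    ‖hf.toLp f‖ ^ 2 = ∫ x, f x ^ 2 := by
  rw [← real_inner_self_eq_norm_sq, inner_toLp_eq]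
  simp only [sq]

theorem measurable_posRPow (e : ℝ) : Measurable (fun u => posRPow u e) := by
  unfold posRPow
  exact Measurable.ite measurableSet_Ioi (by fun_prop) (by fun_prop)

theorem measurable_fbmKernel (θ t : ℝ) : Measurable (fbmKernel θ t) := by
  unfold fbmKernel
  have h := measurable_posRPow (θ - 1/2)
  exact (h.comp (measurable_const.sub measurable_id)).sub (h.comp measurable_neg)

theorem posRPow_mul {t u e : ℝ} (ht : 0 < t) : posRPow (t * u) e = t ^ e * posRPow u e := by
  unfold posRPow
  by_cases hu : 0 < u
  · rw [if_pos hu, if_pos (by positivity), Real.mul_rpow ht.le hu.le]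
  · rw [if_neg hu, if_neg (by
      have : u ≤ 0 := not_lt.1 hu
      nlinarith), mul_zero]

theorem fbmKernel_scale {θ t : ℝ} (ht : 0 < t) (y : ℝ) :
    fbmKernel θ t (t * y) = t ^ (θ - 1/2) * fbmKernel θ 1 y := by
  unfold fbmKernel
  rw [show t - t * y = t * (1 - y) by ring, show -(t * y) = t * (-y) by ring,
    posRPow_mul ht, posRPow_mul ht, mul_sub]

theorem fbmKernel_sub (θ t s x : ℝ) :
    fbmKernel θ t x - fbmKernel θ s x = fbmKernel θ (t - s) (x - s) := by
  unfold fbmKernel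
  rw [show t - s - (x - s) = t - x by ring, show -(x - s) = s - x by ring]
  ring

theorem fbmKernel_zero (θ x : ℝ) : fbmKernel θ 0 x = 0 := by
  unfold fbmKernel; simp

theorem fbmKernel_neg (θ t x : ℝ) : fbmKernel θ t x = - fbmKernel θ (-t) (x - t) := by
  have := fbmKernel_sub θ 0 t x
  rw [fbmKernel_zero, zero_sub, zero_sub] at this
  linarith

theorem memLp_fbmKernel_one {θ : ℝ} (hθ : θ ∈ Ioo (0:ℝ) 1) :
    MemLp (fbmKernel θ 1) 2 (volume : Measure ℝ) := by
  obtain ⟨G, hG, -, h1, -⟩ := kernel_dominated (a := θ) (b := θ) hθ.1 hθ.2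
  refine hG.mono (measurable_fbmKernel θ 1).aestronglyMeasurable (Eventually.of_forall fun x => ?_)
  rw [Real.norm_eq_abs, Real.norm_eq_abs]
  exact (h1 θ ⟨le_rfl, le_rfl⟩ x).trans (le_abs_self _)

theorem memLp_fbmKernel_pos {θ t : ℝ} (hθ : θ ∈ Ioo (0:ℝ) 1) (ht : 0 < t) :
    MemLp (fbmKernel θ t) 2 (volume : Measure ℝ) := by
  have h1 := (memLp_fbmKernel_one hθ).integrable_sq
  rw [memLp_two_iff_integrable_sq (measurable_fbmKernel θ t).aestronglyMeasurable]
  have h2 := (h1.comp_mul_left' (R := t⁻¹) (by positivity)).const_mul ((t ^ (θ - 1/2)) ^ 2)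
  refine h2.congr (Eventually.of_forall fun x => ?_)
  have := fbmKernel_scale (θ := θ) ht (t⁻¹ * x)
  rw [mul_inv_cancel_left₀ ht.ne'] at this
  simp only [this]; ring

theorem memLp_fbmKernel {θ : ℝ} (hθ : θ ∈ Ioo (0:ℝ) 1) (t : ℝ) :
    MemLp (fbmKernel θ t) 2 (volume : Measure ℝ) := by
  rcases lt_trichotomy t 0 with h | h | h
  · have h1 := memLp_fbmKernel_pos hθ (neg_pos.2 h)
    have h2 := (h1.comp_measurePreserving (measurePreserving_sub_right volume t)).neg
    refine h2.congr_norm (measurable_fbmKernel θ t).aestronglyMeasurable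
      (Eventually.of_forall fun x => ?_)
    rw [fbmKernel_neg]; rfl
  · subst h
    refine (MemLp.zero (α := ℝ) (ε := ℝ)).congr_norm
      (measurable_fbmKernel θ 0).aestronglyMeasurable (Eventually.of_forall fun x => ?_)
    rw [fbmKernel_zero]; rfl
  · exact memLp_fbmKernel_pos hθ h

open Classical in
/-- The kernel as an element of `L²(ℝ)`. -/
def kap (θ t : ℝ) : Lp ℝ 2 (volume : Measure ℝ) :=
  if h : MemLp (fbmKernel θ t) 2 (volume : Measure ℝ) then h.toLp (fbmKernel θ t) else 0

theorem kap_eq {θ : ℝ} (hθ : θ ∈ Ioo (0:ℝ) 1) (t : ℝ) :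
    kap θ t = (memLp_fbmKernel hθ t).toLp (fbmKernel θ t) := dif_pos _

theorem inner_kap {θ θ' : ℝ} (hθ : θ ∈ Ioo (0:ℝ) 1) (hθ' : θ' ∈ Ioo (0:ℝ) 1) (t t' : ℝ) :
    inner ℝ (kap θ t) (kap θ' t') = ∫ x, fbmKernel θ t x * fbmKernel θ' t' x := by
  rw [kap_eq hθ, kap_eq hθ', inner_toLp_eq]

theorem kap_sub {θ θ' : ℝ} (hθ : θ ∈ Ioo (0:ℝ) 1) (hθ' : θ' ∈ Ioo (0:ℝ) 1) (t t' : ℝ) :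
    kap θ t - kap θ' t' = ((memLp_fbmKernel hθ t).sub (memLp_fbmKernel hθ' t')).toLp
      (fbmKernel θ t - fbmKernel θ' t') := by
  rw [kap_eq hθ, kap_eq hθ', MemLp.toLp_sub]

theorem norm_kap_sub_sq {θ θ' : ℝ} (hθ : θ ∈ Ioo (0:ℝ) 1) (hθ' : θ' ∈ Ioo (0:ℝ) 1) (t t' : ℝ) :
    ‖kap θ t - kap θ' t'‖ ^ 2 = ∫ x, (fbmKernel θ t x - fbmKernel θ' t' x) ^ 2 := by
  rw [kap_sub hθ hθ', norm_toLp_sq]; rfl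

theorem integral_scale (F : ℝ → ℝ) {t : ℝ} (ht : 0 < t) : ∫ x, F x = t * ∫ y, F (t * y) := by
  rw [Measure.integral_comp_mul_left F t, abs_of_pos (by positivity), smul_eq_mul,
    mul_inv_cancel_left₀ ht.ne']

theorem integral_sq_le {F G : ℝ → ℝ} {c : ℝ} (hG : MemLp G 2 (volume : Measure ℝ))
    (hF : ∀ x, |F x| ≤ c * G x) : ∫ x, F x ^ 2 ≤ c ^ 2 * ∫ x, G x ^ 2 := by
  rw [← integral_const_mul]
  refine integral_mono_of_nonneg (Eventually.of_forall fun x => sq_nonneg _)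
    (hG.integrable_sq.const_mul _) (Eventually.of_forall fun x => ?_)
  simp only
  rw [← mul_pow, ← sq_abs (F x)]
  exact pow_le_pow_left₀ (abs_nonneg _) (hF x) 2

theorem Icc_sub_Ioo {a b θ : ℝ} (ha : 0 < a) (hb : b < 1) (hθ : θ ∈ Icc a b) :
    θ ∈ Ioo (0:ℝ) 1 := ⟨ha.trans_le hθ.1, hθ.2.trans_lt hb⟩

theorem kap_time {a b : ℝ} (ha : 0 < a) (hb : b < 1) : ∃ C, 0 < C ∧ ∀ θ ∈ Icc a b, ∀ t s,
    ‖kap θ t - kap θ s‖ ≤ C * |t - s| ^ θ := by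
  obtain ⟨G, hG, hG0, h1, -⟩ := kernel_dominated ha hb
  refine ⟨√(∫ x, G x ^ 2) + 1, by positivity, fun θ hθ t s => ?_⟩
  have hθ' := Icc_sub_Ioo ha hb hθ
  have hI : 0 ≤ ∫ x, G x ^ 2 := integral_nonneg fun x => sq_nonneg _
  have key : ∀ r, 0 < r → ∫ x, fbmKernel θ r x ^ 2 ≤ (r ^ θ) ^ 2 * ∫ x, G x ^ 2 := by
    intro r hr
    rw [integral_scale _ hr]
    have h2 := integral_sq_le (F := fun y => fbmKernel θ r (r * y)) (c := r ^ (θ - 1/2)) hG (by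
      intro y
      rw [fbmKernel_scale hr, abs_mul, abs_of_nonneg (by positivity)]
      gcongr
      exact h1 θ hθ y)
    have h3 : (r ^ θ) ^ 2 = r * (r ^ (θ - 1/2)) ^ 2 := by
      rw [← Real.rpow_natCast, ← Real.rpow_natCast, ← Real.rpow_mul hr.le, ← Real.rpow_mul hr.le]
      nth_rewrite 2 [← Real.rpow_one r]
      rw [← Real.rpow_add hr]
      congr 1; push_cast; ring
    rw [h3, mul_assoc]
    gcongr
  have hfin : ∀ t s, s < t → ‖kap θ t - kap θ s‖ ≤ (√(∫ x, G x ^ 2) + 1) * |t - s| ^ θ := by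
    intro t s hst
    have h3 : ‖kap θ t - kap θ s‖ ^ 2 ≤ (√(∫ x, G x ^ 2) * |t - s| ^ θ) ^ 2 := by
      rw [norm_kap_sub_sq hθ' hθ', mul_pow, Real.sq_sqrt hI, abs_of_pos (sub_pos.2 hst), mul_comm]
      simp only [fbmKernel_sub]
      rw [integral_sub_right_eq_self (fun x => fbmKernel θ (t - s) x ^ 2) s]
      exact key _ (sub_pos.2 hst)
    have h4 := le_of_sq_le_sq0 h3 (by positivity)
    have : 0 ≤ |t - s| ^ θ := by positivity
    linarith
  rcases lt_trichotomy s t with h | h | h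
  · exact hfin t s h
  · subst h; simp; positivity
  · rw [norm_sub_rev, abs_sub_comm]; exact hfin s t h

theorem kap_param {a b T : ℝ} (ha : 0 < a) (hb : b < 1) (hT : 1 ≤ T) : ∃ C, 0 < C ∧
    ∀ θ ∈ Icc a b, ∀ θ' ∈ Icc a b, ∀ t ∈ Icc (-T) T,
    ‖kap θ t - kap θ' t‖ ≤ C * |θ - θ'| := by
  obtain ⟨G, hG, hG0, h1, h2⟩ := kernel_dominated ha hb
  have hI : 0 ≤ ∫ x, G x ^ 2 := integral_nonneg fun x => sq_nonneg _
  have hT0 : 0 < T := by linarith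
  refine ⟨(1 / a + T ^ 2 + T) * √(∫ x, G x ^ 2) + 1, by positivity, fun θ hθ θ' hθ' t ht => ?_⟩
  have hθ1 := Icc_sub_Ioo ha hb hθ
  have hθ1' := Icc_sub_Ioo ha hb hθ'
  have key : ∀ r, 0 < r → r ≤ T → ∫ x, (fbmKernel θ r x - fbmKernel θ' r x) ^ 2
      ≤ ((1 / a + T ^ 2 + T) * |θ - θ'|) ^ 2 * ∫ x, G x ^ 2 := by
    intro r hr hrT
    rw [integral_scale _ hr]
    have hh : ∀ e : ℝ, r ^ (e - 1/2) = r ^ (-(1/2) : ℝ) * r ^ e := by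
      intro e; rw [← Real.rpow_add hr]; congr 1; ring
    have h3 := integral_sq_le (F := fun y => fbmKernel θ r (r * y) - fbmKernel θ' r (r * y))
      (c := r ^ (-(1/2) : ℝ) * ((1 / a + T ^ 2 + T) * |θ - θ'|)) hG (by
      intro y
      rw [fbmKernel_scale hr, fbmKernel_scale hr, hh θ, hh θ', mul_assoc, mul_assoc, ← mul_sub,
        abs_mul, abs_of_nonneg (by positivity), mul_assoc]
      refine mul_le_mul_of_nonneg_left ?_ (by positivity)
      have e : r ^ θ * fbmKernel θ 1 y - r ^ θ' * fbmKernel θ' 1 y =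
        (r ^ θ - r ^ θ') * fbmKernel θ 1 y + r ^ θ' * (fbmKernel θ 1 y - fbmKernel θ' 1 y) := by ring
      have e1 : |r ^ θ - r ^ θ'| ≤ (1 / a + T ^ 2) * |θ - θ'| :=
        rpow_sub_rpow_exponent_le ha hT hr hrT ⟨hθ.1, hθ1.2.le⟩ ⟨hθ'.1, hθ1'.2.le⟩
      have e2 : r ^ θ' ≤ T := by
        calc r ^ θ' ≤ T ^ θ' := Real.rpow_le_rpow hr.le hrT hθ1'.1.le
          _ ≤ T ^ (1:ℝ) := Real.rpow_le_rpow_of_exponent_le hT hθ1'.2.le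
          _ = T := Real.rpow_one T
      rw [e]
      calc _ ≤ |(r ^ θ - r ^ θ') * fbmKernel θ 1 y|
            + |r ^ θ' * (fbmKernel θ 1 y - fbmKernel θ' 1 y)| := abs_add_le _ _
        _ = |r ^ θ - r ^ θ'| * |fbmKernel θ 1 y|
            + r ^ θ' * |fbmKernel θ 1 y - fbmKernel θ' 1 y| := by
              rw [abs_mul, abs_mul, abs_of_nonneg (Real.rpow_nonneg hr.le θ')]
        _ ≤ ((1 / a + T ^ 2) * |θ - θ'|) * G y + T * (|θ - θ'| * G y) :=
            add_le_add (mul_le_mul e1 (h1 θ hθ y) (abs_nonneg _) (by positivity))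
              (mul_le_mul e2 (h2 θ hθ θ' hθ' y) (abs_nonneg _) hT0.le)
        _ = _ := by ring)
    have h4 : r * (r ^ (-(1/2) : ℝ)) ^ 2 = 1 := by
      rw [← Real.rpow_natCast, ← Real.rpow_mul hr.le]
      nth_rewrite 1 [← Real.rpow_one r]
      rw [← Real.rpow_add hr]
      norm_num
    calc _ ≤ r * ((r ^ (-(1/2) : ℝ) * ((1 / a + T ^ 2 + T) * |θ - θ'|)) ^ 2 * ∫ x, G x ^ 2) := by
          gcongr
      _ = (r * (r ^ (-(1/2) : ℝ)) ^ 2) * (((1 / a + T ^ 2 + T) * |θ - θ'|) ^ 2 * ∫ x, G x ^ 2) := by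
          ring
      _ = _ := by rw [h4, one_mul]
  have h5 : ∫ x, (fbmKernel θ t x - fbmKernel θ' t x) ^ 2
      ≤ ((1 / a + T ^ 2 + T) * |θ - θ'|) ^ 2 * ∫ x, G x ^ 2 := by
    rcases lt_trichotomy t 0 with h | h | h
    · have := key (-t) (by linarith) (by linarith [ht.1])
      rw [← integral_sub_right_eq_self (fun x => (fbmKernel θ (-t) x - fbmKernel θ' (-t) x) ^ 2) t]
        at this
      refine le_of_eq_of_le (integral_congr_ae (Eventually.of_forall fun x => ?_)) this
      simp only
      rw [fbmKernel_neg θ, fbmKernel_neg θ']; ring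
    · subst h
      simp only [fbmKernel_zero, sub_zero]
      simp; positivity
    · exact key t h ht.2
  rw [← norm_kap_sub_sq hθ1 hθ1'] at h5
  have h6 : ‖kap θ t - kap θ' t‖ ^ 2 ≤ ((1 / a + T ^ 2 + T) * |θ - θ'| * √(∫ x, G x ^ 2)) ^ 2 := by
    rw [mul_pow _ (√_), Real.sq_sqrt hI]; exact h5
  have h7 := le_of_sq_le_sq0 h6 (by positivity)
  have := abs_nonneg (θ - θ')
  nlinarith

theorem kap_split {θ s t : ℝ} (hθ : θ ∈ Ioo (0:ℝ) 1) (hst : s < t) :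
    ∃ g : Lp ℝ 2 (volume : Measure ℝ), (t - s) ^ θ / 2 ≤ ‖g‖ ∧
      inner ℝ g (kap θ t - kap θ s - g) = 0 ∧
      ∀ s' t', s' ≤ s → t' ≤ s → inner ℝ g (kap θ t' - kap θ s') = 0 := by
  have hf := (memLp_fbmKernel hθ t).sub (memLp_fbmKernel hθ s)
  have hg := hf.indicator (measurableSet_Ioo (a := s) (b := t))
  refine ⟨hg.toLp _, ?_, ?_, ?_⟩
  · have h1 : ‖hg.toLp _‖ ^ 2 = (t - s) ^ (2 * θ) / (2 * θ) := by
      rw [norm_toLp_sq]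
      have e : ∀ x, ((Ioo s t).indicator (fbmKernel θ t - fbmKernel θ s) x) ^ 2
          = (Ioo s t).indicator (fun x => (t - x) ^ (2 * θ - 1)) x := by
        intro x
        by_cases hx : x ∈ Ioo s t
        · rw [indicator_of_mem hx, indicator_of_mem hx, Pi.sub_apply]
          unfold fbmKernel posRPow
          rw [if_pos (sub_pos.2 hx.2), if_neg (by linarith [hx.1] : ¬ 0 < s - x)]
          have : (t - x) ^ (2 * θ - 1) = ((t - x) ^ (θ - 1/2)) ^ 2 := by
            rw [← Real.rpow_natCast, ← Real.rpow_mul (by linarith [hx.2])]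
            congr 1; push_cast; ring
          rw [this]; ring
        · rw [indicator_of_notMem hx, indicator_of_notMem hx]; norm_num
      simp only [e]
      rw [integral_indicator measurableSet_Ioo, ← integral_Ioc_eq_integral_Ioo,
        ← intervalIntegral.integral_of_le hst.le,
        intervalIntegral.integral_comp_sub_left (fun x => x ^ (2 * θ - 1)) t, sub_self,
        integral_rpow (Or.inl (by linarith [hθ.1])), sub_add_cancel,
        Real.zero_rpow (by linarith [hθ.1]), sub_zero]
    refine le_of_sq_le_sq0 ?_ (norm_nonneg _)
    rw [h1]
    have h2 : (t - s) ^ (2 * θ) = ((t - s) ^ θ) ^ 2 := by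
      rw [← Real.rpow_natCast, ← Real.rpow_mul (by linarith)]
      congr 1; push_cast; ring
    rw [h2, le_div_iff₀ (by linarith [hθ.1])]
    nlinarith [sq_nonneg ((t - s) ^ θ), hθ.2, hθ.1]
  · rw [kap_sub hθ hθ, ← MemLp.toLp_sub, inner_toLp_eq]
    refine integral_eq_zero_of_ae (Eventually.of_forall fun x => ?_)
    by_cases hx : x ∈ Ioo s t
    · simp [indicator_of_mem hx]
    · simp [indicator_of_notMem hx]
  · intro s' t' hs' ht'
    rw [kap_sub hθ hθ, inner_toLp_eq]
    refine integral_eq_zero_of_ae (Eventually.of_forall fun x => ?_)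
    by_cases hx : x ∈ Ioo s t
    · have : fbmKernel θ t' x - fbmKernel θ s' x = 0 := by
        unfold fbmKernel posRPow
        rw [if_neg (by linarith [hx.1] : ¬ 0 < t' - x), if_neg (by linarith [hx.1] : ¬ 0 < s' - x)]
        ring
      simp [this]
    · simp [indicator_of_notMem hx]

end kernelL2

section events

/-- The margin used at stage `q`. -/
def cq (q : ℕ) : ℝ := 1 / (q + 3)

theorem cq_pos (q : ℕ) : 0 < cq q := by unfold cq; positivity

theorem cq_lt (q : ℕ) : 1 - cq q < 1 := by linarith [cq_pos q]

/-- Deterministic path estimates at stage `q`. -/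
structure GoodPath (X : ℝ → ℝ → ℝ) (q : ℕ) : Prop where
  incr : ∀ᶠ n : ℕ in atTop, ∀ (k : ℤ) (j : ℕ), |k| ≤ q * 2 ^ n →
    (j / 8 ^ n : ℝ) ∈ Icc (cq q) (1 - cq q) →
    |X (j / 8 ^ n) ((k + 1) / 2 ^ n) - X (j / 8 ^ n) (k / 2 ^ n)|
      ≤ (2:ℝ) ^ (-(n:ℝ) * ((j / 8 ^ n : ℝ) - cq q))
  param : ∀ᶠ n : ℕ in atTop, ∀ r ≤ 8, ∀ (k : ℤ) (j : ℕ), |k| ≤ q * 2 ^ n →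
    (j / 8 ^ n : ℝ) ∈ Icc (cq q) (1 - cq q) →
    (((8 * j + r : ℕ) : ℝ) / 8 ^ (n + 1)) ∈ Icc (cq q) (1 - cq q) →
    |X (j / 8 ^ n) (k / 2 ^ n) - X (((8 * j + r : ℕ) : ℝ) / 8 ^ (n + 1)) (k / 2 ^ n)|
      ≤ (1 / 4 : ℝ) ^ n
  osc : ∃ N : ℕ, ∀ᶠ n : ℕ in atTop, ∀ (k : ℤ) (j : ℕ), |k| ≤ q * 2 ^ n →
    (j / 8 ^ n : ℝ) ∈ Icc (cq q) (1 - cq q) →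
    ∃ i < N, (2:ℝ) ^ (-(n:ℝ) * ((j / 8 ^ n : ℝ) + cq q)) <
      |X (j / 8 ^ n) ((k + (i + 1 : ℕ)) / 2 ^ n) - X (j / 8 ^ n) ((k + i) / 2 ^ n)|

variable {Ω : Type} {mΩ : MeasurableSpace Ω} {P : Measure Ω} [IsProbabilityMeasure P]

theorem grid_borelCantelli (q : ℕ) {a b : ℝ} (hb : b < 1) (A : ℕ → ℤ → ℕ → Set Ω) (D : ℝ)
    (hA : ∀ (n : ℕ) (k : ℤ) (j : ℕ), |k| ≤ q * 2 ^ n → (j / 8 ^ n : ℝ) ∈ Icc a b →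
      P (A n k j) ≤ ENNReal.ofReal (D / 32 ^ n)) :
    ∀ᵐ ω ∂P, ∀ᶠ n : ℕ in atTop, ∀ (k : ℤ) (j : ℕ), |k| ≤ q * 2 ^ n →
      (j / 8 ^ n : ℝ) ∈ Icc a b → ω ∉ A n k j := by
  classical
  let S : ℕ → Finset (ℤ × ℕ) := fun n =>
    ((Finset.Icc (-(q * 2 ^ n : ℤ)) (q * 2 ^ n)) ×ˢ Finset.range (8 ^ n + 1)).filter
      fun p => (p.2 / 8 ^ n : ℝ) ∈ Icc a b
  let U : ℕ → Set Ω := fun n => ⋃ p ∈ S n, A n p.1 p.2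
  have hcard : ∀ n, ((S n).card : ℝ) ≤ (2 * q + 1) * 2 * 16 ^ n := by
    intro n
    have h1 : (S n).card ≤ (2 * (q * 2 ^ n) + 1) * (8 ^ n + 1) := by
      refine (Finset.card_filter_le _ _).trans ?_
      rw [Finset.card_product, Finset.card_range, Int.card_Icc]
      refine Nat.mul_le_mul_right _ ?_
      have : ((q * 2 ^ n : ℤ) + 1 - -(q * 2 ^ n)).toNat = 2 * (q * 2 ^ n) + 1 := by
        have : ((q * 2 ^ n : ℤ) + 1 - -(q * 2 ^ n)) = ((2 * (q * 2 ^ n) + 1 : ℕ) : ℤ) := by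
          push_cast; ring
        rw [this, Int.toNat_natCast]
      rw [this]
    have h2 : ((S n).card : ℝ) ≤ (2 * (q * 2 ^ n) + 1) * (8 ^ n + 1) := by exact_mod_cast h1
    have h3 : (1:ℝ) ≤ 2 ^ n := one_le_pow₀ (by norm_num)
    have h4 : (1:ℝ) ≤ 8 ^ n := one_le_pow₀ (by norm_num)
    have h5 : (16:ℝ) ^ n = 2 ^ n * 8 ^ n := by rw [← mul_pow]; norm_num
    refine h2.trans ?_
    calc (2 * ((q:ℝ) * 2 ^ n) + 1) * (8 ^ n + 1) ≤ ((2 * q + 1) * 2 ^ n) * (2 * 8 ^ n) := by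
          gcongr
          · nlinarith
          · linarith
      _ = _ := by rw [h5]; ring
  have hU : ∀ n, P (U n) ≤ ENNReal.ofReal (((2 * q + 1) * 2 * |D|) * (1 / 2) ^ n) := by
    intro n
    calc P (U n) ≤ ∑ p ∈ S n, P (A n p.1 p.2) := measure_biUnion_finset_le _ _
      _ ≤ ∑ p ∈ S n, ENNReal.ofReal (|D| / 32 ^ n) := by
          refine Finset.sum_le_sum fun p hp => ?_
          obtain ⟨h1, h2⟩ := Finset.mem_filter.1 hp
          rw [Finset.mem_product, Finset.mem_Icc] at h1
          refine (hA n p.1 p.2 (abs_le.2 h1.1) h2).trans (ENNReal.ofReal_le_ofReal ?_)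
          gcongr; exact le_abs_self D
      _ = ENNReal.ofReal ((S n).card * (|D| / 32 ^ n)) := by
          rw [Finset.sum_const, nsmul_eq_mul, ENNReal.ofReal_mul (by positivity),
            ENNReal.ofReal_natCast]
      _ ≤ _ := by
          refine ENNReal.ofReal_le_ofReal ?_
          calc ((S n).card : ℝ) * (|D| / 32 ^ n) ≤ ((2 * q + 1) * 2 * 16 ^ n) * (|D| / 32 ^ n) := by
                gcongr; exact hcard n
            _ = _ := by
                have : (32:ℝ) ^ n = 16 ^ n * 2 ^ n := by rw [← mul_pow]; norm_num
                rw [this, one_div, inv_pow]; field_simp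
  have hsum : ∑' n, P (U n) ≠ ⊤ := by
    have hs : Summable fun n : ℕ => ((2 * q + 1) * 2 * |D|) * (1 / 2 : ℝ) ^ n :=
      (summable_geometric_of_lt_one (by norm_num) (by norm_num)).mul_left _
    refine ne_top_of_le_ne_top ?_ (ENNReal.tsum_le_tsum hU)
    exact hs.tsum_ofReal_ne_top
  filter_upwards [ae_eventually_notMem hsum] with ω hω
  filter_upwards [hω] with n hn k j hk hj hmem
  refine hn (mem_biUnion (x := (k, j)) ?_ hmem)
  refine Finset.mem_coe.2 (Finset.mem_filter.2 ⟨Finset.mem_product.2 ⟨?_, ?_⟩, hj⟩)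
  · rw [Finset.mem_Icc]; exact abs_le.1 hk
  · rw [Finset.mem_range, Nat.lt_succ_iff]
    have h1 : (j:ℝ) / 8 ^ n ≤ 1 := hj.2.trans hb.le
    rw [div_le_one (by positivity)] at h1
    exact_mod_cast h1

variable (W : Lp ℝ 2 (volume : Measure ℝ) →ₗᵢ[ℝ] Lp ℝ 2 P)

theorem W_sub_ae (f g : Lp ℝ 2 (volume : Measure ℝ)) :
    (W (f - g) : Ω → ℝ) =ᵐ[P] fun ω => W f ω - W g ω := by
  rw [map_sub]
  exact Lp.coeFn_sub _ _

theorem measure_lt_diff (f g : Lp ℝ 2 (volume : Measure ℝ)) (l : ℝ) :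
    P {ω | l < |W f ω - W g ω|} = P {ω | l < |W (f - g) ω|} := by
  refine measure_congr ?_
  filter_upwards [W_sub_ae W f g] with ω h
  change (l < |W f ω - W g ω|) = (l < |W (f - g) ω|)
  rw [h]

theorem two_rpow_pow_bound {e : ℝ} {m : ℕ} (hm : 5 ≤ e * m) (n : ℕ) :
    (32:ℝ) ^ n ≤ ((2:ℝ) ^ ((n:ℝ) * e)) ^ m := by
  have h1 : (32:ℝ) ^ n = (2:ℝ) ^ ((n:ℝ) * 5) := by
    rw [mul_comm, Real.rpow_mul (by norm_num), Real.rpow_natCast]; norm_num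
  rw [h1, ← Real.rpow_natCast, ← Real.rpow_mul (by norm_num), mul_assoc]
  gcongr
  norm_num

theorem exists_mul_ge {e : ℝ} (he : 0 < e) : ∃ m : ℕ, 5 ≤ e * m := by
  obtain ⟨m, hm⟩ := exists_nat_ge (5 / e)
  exact ⟨m, by rwa [div_le_iff₀' he] at hm⟩

theorem ae_incr (hW : ∀ f, P.map (W f) = gaussianReal 0 (‖f‖₊ ^ 2)) (q : ℕ) :
    ∀ᵐ ω ∂P, ∀ᶠ n : ℕ in atTop, ∀ (k : ℤ) (j : ℕ), |k| ≤ q * 2 ^ n →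
    (j / 8 ^ n : ℝ) ∈ Icc (cq q) (1 - cq q) →
    |W (kap (j / 8 ^ n) ((k + 1) / 2 ^ n)) ω - W (kap (j / 8 ^ n) (k / 2 ^ n)) ω|
      ≤ (2:ℝ) ^ (-(n:ℝ) * ((j / 8 ^ n : ℝ) - cq q)) := by
  obtain ⟨C, hC, hK⟩ := kap_time (cq_pos q) (cq_lt q)
  obtain ⟨m, hm⟩ := exists_mul_ge (cq_pos q)
  obtain ⟨D, hD, hT⟩ := isonormal_tail W hW m
  have := grid_borelCantelli (P := P) q (a := cq q) (cq_lt q)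
    (fun n k j => {ω | (2:ℝ) ^ (-(n:ℝ) * ((j / 8 ^ n : ℝ) - cq q)) <
      |W (kap (j / 8 ^ n) ((k + 1) / 2 ^ n)) ω - W (kap (j / 8 ^ n) (k / 2 ^ n)) ω|})
    (D * C ^ m) (by
      intro n k j hk hj
      rw [measure_lt_diff]
      set θ : ℝ := j / 8 ^ n
      have h1 := hK θ hj ((k + 1) / 2 ^ n) (k / 2 ^ n)
      have e1 : ((k:ℝ) + 1) / 2 ^ n - k / 2 ^ n = (2:ℝ) ^ (-(n:ℝ)) := by
        rw [Real.rpow_neg (by norm_num), Real.rpow_natCast]; ring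
      rw [e1, abs_of_nonneg (by positivity), ← Real.rpow_mul (by norm_num)] at h1
      have h2 := hT _ _ ((2:ℝ) ^ ((n:ℝ) * cq q) / C) (by positivity) (by positivity) h1
      have e2 : (2:ℝ) ^ ((n:ℝ) * cq q) / C * (C * 2 ^ (-(n:ℝ) * θ)) =
          (2:ℝ) ^ (-(n:ℝ) * (θ - cq q)) := by
        rw [div_mul_eq_mul_div, mul_left_comm, mul_div_cancel_left₀ _ hC.ne',
          ← Real.rpow_add (by norm_num)]
        congr 1; ring
      rw [e2] at h2
      refine h2.trans (ENNReal.ofReal_le_ofReal ?_)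
      rw [div_pow, div_div_eq_mul_div]
      gcongr
      exact two_rpow_pow_bound hm n)
  filter_upwards [this] with ω hω
  filter_upwards [hω] with n hn k j hk hj
  exact not_lt.1 (hn k j hk hj)

theorem ae_param (hW : ∀ f, P.map (W f) = gaussianReal 0 (‖f‖₊ ^ 2)) (q : ℕ) :
    ∀ᵐ ω ∂P, ∀ᶠ n : ℕ in atTop, ∀ r ≤ 8, ∀ (k : ℤ) (j : ℕ), |k| ≤ q * 2 ^ n →
    (j / 8 ^ n : ℝ) ∈ Icc (cq q) (1 - cq q) →
    (((8 * j + r : ℕ) : ℝ) / 8 ^ (n + 1)) ∈ Icc (cq q) (1 - cq q) →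
    |W (kap (j / 8 ^ n) (k / 2 ^ n)) ω - W (kap (((8 * j + r : ℕ) : ℝ) / 8 ^ (n + 1)) (k / 2 ^ n)) ω|
      ≤ (1 / 4 : ℝ) ^ n := by
  obtain ⟨C, hC, hK⟩ := kap_param (T := q + 1) (cq_pos q) (cq_lt q) (by simp)
  obtain ⟨D, hD, hT⟩ := isonormal_tail W hW 5
  have : ∀ r : ℕ, ∀ᵐ ω ∂P, r ≤ 8 → ∀ᶠ n : ℕ in atTop, ∀ (k : ℤ) (j : ℕ), |k| ≤ q * 2 ^ n →
    (j / 8 ^ n : ℝ) ∈ Icc (cq q) (1 - cq q) →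
    ω ∉ {ω | (((8 * j + r : ℕ) : ℝ) / 8 ^ (n + 1)) ∈ Icc (cq q) (1 - cq q) ∧ (1 / 4 : ℝ) ^ n <
    |W (kap (j / 8 ^ n) (k / 2 ^ n)) ω - W (kap (((8 * j + r : ℕ) : ℝ) / 8 ^ (n + 1)) (k / 2 ^ n)) ω|}
    := by
    intro r
    by_cases hr : r ≤ 8
    swap
    · exact Eventually.of_forall fun ω h => absurd h hr
    have := grid_borelCantelli (P := P) q (a := cq q) (cq_lt q)
      (fun n k j => {ω | (((8 * j + r : ℕ) : ℝ) / 8 ^ (n + 1)) ∈ Icc (cq q) (1 - cq q) ∧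
        (1 / 4 : ℝ) ^ n < |W (kap (j / 8 ^ n) (k / 2 ^ n)) ω -
          W (kap (((8 * j + r : ℕ) : ℝ) / 8 ^ (n + 1)) (k / 2 ^ n)) ω|})
      (D * C ^ 5) (by
        intro n k j hk hj
        by_cases hj' : (((8 * j + r : ℕ) : ℝ) / 8 ^ (n + 1)) ∈ Icc (cq q) (1 - cq q)
        swap
        · simp only [hj', false_and, Set.ofPred_false, measure_empty, zero_le]
        simp only [hj', true_and]
        rw [measure_lt_diff]
        have h2n : (0:ℝ) < 2 ^ n := by positivity
        have hk' : (k / 2 ^ n : ℝ) ∈ Icc (-((q:ℝ) + 1)) (q + 1) := by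
          have h1 : |(k:ℝ)| ≤ q * 2 ^ n := by exact_mod_cast hk
          obtain ⟨h2, h3⟩ := abs_le.1 h1
          constructor
          · rw [le_div_iff₀ h2n]; nlinarith
          · rw [div_le_iff₀ h2n]; nlinarith
        have h1 := hK _ hj _ hj' _ hk'
        have e1 : |(j / 8 ^ n : ℝ) - ((8 * j + r : ℕ) : ℝ) / 8 ^ (n + 1)| ≤ (1 / 8) ^ n := by
          have : (j / 8 ^ n : ℝ) - ((8 * j + r : ℕ) : ℝ) / 8 ^ (n + 1) = - ((r / 8) * (1/8) ^ n) := by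
            push_cast; rw [pow_succ, one_div, inv_pow]; field_simp; ring
          rw [this, abs_neg, abs_of_nonneg (by positivity)]
          have hr' : (r:ℝ) ≤ 8 := by exact_mod_cast hr
          have : (r:ℝ) / 8 ≤ 1 := by linarith
          exact mul_le_of_le_one_left (by positivity) this
        have h1' := h1.trans (mul_le_mul_of_nonneg_left e1 hC.le)
        have h2 := hT _ _ ((2:ℝ) ^ n / C) (by positivity) (by positivity) h1'
        have e2 : (2:ℝ) ^ n / C * (C * (1 / 8) ^ n) = (1 / 4) ^ n := by
          rw [div_mul_eq_mul_div, mul_left_comm, mul_div_cancel_left₀ _ hC.ne', ← mul_pow]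
          norm_num
        rw [e2] at h2
        refine h2.trans (ENNReal.ofReal_le_ofReal (le_of_eq ?_))
        rw [div_pow, div_div_eq_mul_div, ← pow_mul, mul_comm n 5, pow_mul]
        norm_num)
    filter_upwards [this] with ω hω _
    exact hω
  filter_upwards [ae_all_iff.2 this] with ω hω
  have h2 : ∀ᶠ n : ℕ in atTop, ∀ r ∈ Finset.range 9, _ :=
    (Filter.eventually_all_finset _).2 fun r hr =>
      hω r (Nat.lt_succ_iff.1 (Finset.mem_range.1 hr))
  filter_upwards [h2] with n hn r hr k j hk hj hj'
  have := hn r (Finset.mem_range.2 (Nat.lt_succ_iff.2 hr)) k j hk hj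
  by_contra hcon
  exact this ⟨hj', not_le.1 hcon⟩

theorem ae_osc (hW : ∀ f, P.map (W f) = gaussianReal 0 (‖f‖₊ ^ 2)) (q : ℕ) :
    ∃ N : ℕ, ∀ᵐ ω ∂P, ∀ᶠ n : ℕ in atTop, ∀ (k : ℤ) (j : ℕ), |k| ≤ q * 2 ^ n →
    (j / 8 ^ n : ℝ) ∈ Icc (cq q) (1 - cq q) →
    ∃ i < N, (2:ℝ) ^ (-(n:ℝ) * ((j / 8 ^ n : ℝ) + cq q)) <
      |W (kap (j / 8 ^ n) ((k + (i + 1 : ℕ)) / 2 ^ n)) ω - W (kap (j / 8 ^ n) ((k + i) / 2 ^ n)) ω| := by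
  obtain ⟨N, hN⟩ := exists_mul_ge (cq_pos q)
  refine ⟨N, ?_⟩
  have := grid_borelCantelli (P := P) q (a := cq q) (cq_lt q)
    (fun n k j => {ω | ∀ i < N, |W (kap (j / 8 ^ n) ((k + (i + 1 : ℕ)) / 2 ^ n)) ω -
      W (kap (j / 8 ^ n) ((k + i) / 2 ^ n)) ω| ≤ (2:ℝ) ^ (-(n:ℝ) * ((j / 8 ^ n : ℝ) + cq q))})
    (2 ^ N) (by
      intro n k j hk hj
      set θ : ℝ := j / 8 ^ n
      have hθ : θ ∈ Ioo (0:ℝ) 1 := Icc_sub_Ioo (cq_pos q) (cq_lt q) hj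
      have h2n : (0:ℝ) < 2 ^ n := by positivity
      have hlt : ∀ i : ℕ, ((k:ℝ) + i) / 2 ^ n < (k + (i + 1 : ℕ)) / 2 ^ n := by
        intro i; gcongr; norm_num
      choose g hg1 hg2 hg3 using fun i : ℕ => kap_split hθ (hlt i)
      let f : ℕ → Lp ℝ 2 (volume : Measure ℝ) := fun i =>
        kap θ ((k + (i + 1 : ℕ)) / 2 ^ n) - kap θ ((k + i) / 2 ^ n)
      have hσ : ∀ i, (2:ℝ) ^ (-(n:ℝ) * θ) / 2 ≤ ‖g i‖ := by
        intro i
        have e1 : ((k:ℝ) + (i + 1 : ℕ)) / 2 ^ n - (k + i) / 2 ^ n = (2:ℝ) ^ (-(n:ℝ)) := by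
          rw [Real.rpow_neg (by norm_num), Real.rpow_natCast]; push_cast; ring
        have := hg1 i
        rwa [e1, ← Real.rpow_mul (by norm_num)] at this
      have hsb := isonormal_smallball W hW f g (σ := (2:ℝ) ^ (-(n:ℝ) * θ) / 2)
        (δ := (2:ℝ) ^ (-(n:ℝ) * (θ + cq q))) (by positivity) (by positivity) hσ
        (by
          intro i i' hi'
          refine hg3 i _ _ ?_ ?_
          · gcongr
          · gcongr; exact hi') hg2 N
      have e : P {ω | ∀ i < N, |W (kap θ ((k + (i + 1 : ℕ)) / 2 ^ n)) ω -
          W (kap θ ((k + i) / 2 ^ n)) ω| ≤ (2:ℝ) ^ (-(n:ℝ) * (θ + cq q))} =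
          P {ω | ∀ i < N, |W (f i) ω| ≤ (2:ℝ) ^ (-(n:ℝ) * (θ + cq q))} := by
        refine measure_congr ?_
        have hall : ∀ᵐ ω ∂P, ∀ i, W (f i) ω = W (kap θ ((k + (i + 1 : ℕ)) / 2 ^ n)) ω -
          W (kap θ ((k + i) / 2 ^ n)) ω := ae_all_iff.2 fun i => W_sub_ae W _ _
        filter_upwards [hall] with ω h
        change (∀ i < N, _) = (∀ i < N, _)
        simp only [h]
      rw [e]
      refine hsb.trans ?_
      rw [← ENNReal.ofReal_pow (by positivity)]
      refine ENNReal.ofReal_le_ofReal ?_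
      have e3 : (2:ℝ) ^ (-(n:ℝ) * (θ + cq q)) / (2 ^ (-(n:ℝ) * θ) / 2) =
          2 / (2:ℝ) ^ ((n:ℝ) * cq q) := by
        rw [show -(n:ℝ) * (θ + cq q) = -(n:ℝ) * θ - n * cq q by ring, Real.rpow_sub (by norm_num)]
        field_simp
      rw [e3, div_pow]
      gcongr
      exact two_rpow_pow_bound hN n)
  filter_upwards [this] with ω hω
  filter_upwards [hω] with n hn k j hk hj
  by_contra hcon
  push Not at hcon
  exact hn k j hk hj hcon

theorem ae_goodPath (hW : ∀ f, P.map (W f) = gaussianReal 0 (‖f‖₊ ^ 2)) :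
    ∀ᵐ ω ∂P, ∀ q, GoodPath (fun θ t => W (kap θ t) ω) q := by
  refine ae_all_iff.2 fun q => ?_
  obtain ⟨N, hN⟩ := ae_osc W hW q
  filter_upwards [ae_incr W hW q, ae_param W hW q, hN] with ω h1 h2 h3
  exact ⟨h1, h2, N, h3⟩

end events

section pathwise

/-- Dyadic approximation index in time. -/
def kf (t : ℝ) (n : ℕ) : ℤ := ⌊(2:ℝ) ^ n * t⌋

/-- Approximation index in the parameter. -/
def jf (θ : ℝ) (n : ℕ) : ℕ := ⌊(8:ℝ) ^ n * θ⌋₊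

theorem jf_le {θ : ℝ} (hθ : 0 < θ) (n : ℕ) : (jf θ n : ℝ) / 8 ^ n ≤ θ := by
  rw [div_le_iff₀' (by positivity)]
  exact Nat.floor_le (by positivity)

theorem le_jf (θ : ℝ) (n : ℕ) : θ - (1 / 8) ^ n ≤ (jf θ n : ℝ) / 8 ^ n := by
  have h : (0:ℝ) < 8 ^ n := by positivity
  rw [le_div_iff₀' h, mul_sub, ← mul_pow]
  have := Nat.lt_floor_add_one ((8:ℝ) ^ n * θ)
  norm_num
  unfold jf
  linarith

theorem jf_succ {θ : ℝ} (hθ : 0 < θ) (n : ℕ) : ∃ r ≤ 8, jf θ (n + 1) = 8 * jf θ n + r := by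
  have h0 : (0:ℝ) ≤ (8:ℝ) ^ n * θ := by positivity
  have h1 := Nat.floor_le h0
  have h2 := Nat.lt_floor_add_one ((8:ℝ) ^ n * θ)
  have e : (8:ℝ) ^ (n + 1) * θ = 8 * ((8:ℝ) ^ n * θ) := by ring
  have h3 : 8 * jf θ n ≤ jf θ (n + 1) := by
    unfold jf
    rw [e]
    apply Nat.le_floor
    push_cast
    linarith
  have h4 : jf θ (n + 1) < 8 * jf θ n + 8 := by
    unfold jf
    rw [e, Nat.floor_lt (by positivity)]
    push_cast
    linarith
  exact ⟨jf θ (n + 1) - 8 * jf θ n, by omega, by omega⟩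

theorem kf_succ (t : ℝ) (n : ℕ) : kf t (n + 1) = 2 * kf t n ∨ kf t (n + 1) = 2 * kf t n + 1 := by
  have h1 := Int.floor_le ((2:ℝ) ^ n * t)
  have h2 := Int.lt_floor_add_one ((2:ℝ) ^ n * t)
  have e : (2:ℝ) ^ (n + 1) * t = 2 * ((2:ℝ) ^ n * t) := by ring
  have h3 : 2 * kf t n ≤ kf t (n + 1) := by
    unfold kf
    rw [e, Int.le_floor]
    push_cast
    linarith
  have h4 : kf t (n + 1) < 2 * kf t n + 2 := by
    unfold kf
    rw [e, Int.floor_lt]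
    push_cast
    linarith
  omega

theorem kf_abs_le {t : ℝ} {q : ℕ} (ht : |t| ≤ q - 1) (n : ℕ) : |kf t n| ≤ q * 2 ^ n := by
  obtain ⟨h1, h2⟩ := abs_le.1 ht
  have h3 := Int.floor_le ((2:ℝ) ^ n * t)
  have h4 := Int.lt_floor_add_one ((2:ℝ) ^ n * t)
  have h5 : (1:ℝ) ≤ 2 ^ n := one_le_pow₀ (by norm_num)
  have h6 : |(kf t n : ℝ)| ≤ q * 2 ^ n := by
    unfold kf
    rw [abs_le]
    constructor <;> nlinarith
  exact_mod_cast h6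

/-- Estimates for a fixed parameter along its approximating sequence. -/
structure GoodSeq (Y : ℕ → ℝ → ℝ) (θ ε : ℝ) (q n0 N : ℕ) : Prop where
  incr : ∀ n ≥ n0, ∀ k : ℤ, |k| ≤ q * 2 ^ n →
    |Y n ((k + 1) / 2 ^ n) - Y n (k / 2 ^ n)| ≤ 2 * ((2:ℝ) ^ (-(θ - ε))) ^ n
  param : ∀ n ≥ n0, ∀ k : ℤ, |k| ≤ q * 2 ^ n →
    |Y (n + 1) (k / 2 ^ n) - Y n (k / 2 ^ n)| ≤ (1 / 4 : ℝ) ^ n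
  osc : ∀ n ≥ n0, ∀ k : ℤ, |k| ≤ q * 2 ^ n →
    ∃ i < N, (2:ℝ) ^ (-(n:ℝ) * (θ + ε)) <
      |Y n ((k + (i + 1 : ℕ)) / 2 ^ n) - Y n ((k + i) / 2 ^ n)|

theorem goodSeq_of_goodPath {X : ℝ → ℝ → ℝ} {q : ℕ} (hX : GoodPath X q) {θ : ℝ}
    (h1 : 2 * cq q ≤ θ) (h2 : θ ≤ 1 - cq q) :
    ∃ n0 N, GoodSeq (fun n t => X ((jf θ n : ℝ) / 8 ^ n) t) θ (cq q) q n0 N := by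
  have hc := cq_pos q
  have hθ : 0 < θ := by linarith
  obtain ⟨N, hN⟩ := hX.osc
  have hsmall : ∀ᶠ n : ℕ in atTop, (1 / 8 : ℝ) ^ n < cq q :=
    (tendsto_pow_atTop_nhds_zero_of_lt_one (by norm_num) (by norm_num)).eventually_lt_const hc
  obtain ⟨n0, hn0⟩ := eventually_atTop.1 (hX.incr.and (hX.param.and (hN.and hsmall)))
  have hmem : ∀ n ≥ n0, (jf θ n : ℝ) / 8 ^ n ∈ Icc (cq q) (1 - cq q) := by
    intro n hn
    have h3 := (hn0 n hn).2.2.2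
    exact ⟨by linarith [le_jf θ n], (jf_le hθ n).trans h2⟩
  refine ⟨n0, N, ?_, ?_, ?_⟩
  · intro n hn k hk
    refine ((hn0 n hn).1 k _ hk (hmem n hn)).trans ?_
    have h3 := le_jf θ n
    have h4 : (n:ℝ) * (1/8) ^ n ≤ 1 := by
      have : (n:ℝ) ≤ 8 ^ n := by
        exact_mod_cast (Nat.lt_pow_self (by norm_num : 1 < 8)).le
      rw [one_div, inv_pow, ← div_eq_mul_inv]
      exact div_le_one_of_le₀ this (by positivity)
    have e : 2 * ((2:ℝ) ^ (-(θ - cq q))) ^ n = (2:ℝ) ^ (1 + -(θ - cq q) * n) := by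
      rw [Real.rpow_add (by norm_num), Real.rpow_one, Real.rpow_mul (by norm_num),
        Real.rpow_natCast]
    rw [e]
    apply Real.rpow_le_rpow_of_exponent_le (by norm_num)
    have : (0:ℝ) ≤ n := by positivity
    nlinarith
  · intro n hn k hk
    obtain ⟨r, hr, e⟩ := jf_succ hθ n
    have h3 := (hn0 n hn).2.1 r hr k (jf θ n) hk (hmem n hn)
    rw [← e] at h3
    rw [abs_sub_comm]
    exact h3 (hmem (n + 1) (by omega))
  · intro n hn k hk
    obtain ⟨i, hi, h3⟩ := (hn0 n hn).2.2.1 k _ hk (hmem n hn)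
    refine ⟨i, hi, lt_of_le_of_lt ?_ h3⟩
    apply Real.rpow_le_rpow_of_exponent_le (by norm_num)
    have := jf_le hθ n
    have : (0:ℝ) ≤ n := by positivity
    nlinarith

variable {Y : ℕ → ℝ → ℝ} {θ ε : ℝ} {q n0 N : ℕ}

theorem seq_step (hY : GoodSeq Y θ ε q n0 N) (hε : 0 < ε) (h1 : 2 * ε ≤ θ) (h2 : θ ≤ 1 - ε)
    {t : ℝ} (ht : |t| ≤ q - 1) {n : ℕ} (hn : n0 ≤ n) :
    |Y (n + 1) (kf t (n + 1) / 2 ^ (n + 1)) - Y n (kf t n / 2 ^ n)|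
      ≤ 3 * ((2:ℝ) ^ (-(θ - ε))) ^ n := by
  set ρ := (2:ℝ) ^ (-(θ - ε))
  have hρ0 : 0 < ρ := by positivity
  have hρ1 : ρ ≤ 1 := Real.rpow_le_one_of_one_le_of_nonpos (by norm_num) (by linarith)
  have hρ4 : 1 / 4 ≤ ρ := by
    have : (1/4 : ℝ) = (2:ℝ) ^ (-2 : ℝ) := by
      rw [Real.rpow_neg (by norm_num)]; norm_num
    rw [this]
    exact Real.rpow_le_rpow_of_exponent_le (by norm_num) (by linarith)
  have hA := hY.param n hn _ (kf_abs_le ht n)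
  have hA' : (1 / 4 : ℝ) ^ n ≤ ρ ^ n := by gcongr
  have hk2 : |2 * kf t n| ≤ q * 2 ^ (n + 1) := by
    have := kf_abs_le ht n
    rw [abs_mul, pow_succ]; norm_num; linarith
  have hB := hY.incr (n + 1) (by omega) _ hk2
  have hB' : ρ ^ (n + 1) ≤ ρ ^ n := pow_le_pow_of_le_one hρ0.le hρ1 (by omega)
  have e : ((2 * kf t n : ℤ) : ℝ) / 2 ^ (n + 1) = kf t n / 2 ^ n := by
    push_cast; rw [pow_succ]; field_simp
  rw [e] at hB
  have hC : |Y (n + 1) (kf t (n + 1) / 2 ^ (n + 1)) - Y (n + 1) (kf t n / 2 ^ n)|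
      ≤ 2 * ρ ^ (n + 1) := by
    rcases kf_succ t n with h | h
    · rw [h, e, sub_self, abs_zero]; positivity
    · rw [h, Int.cast_add, Int.cast_one]; exact hB
  calc _ ≤ _ := abs_sub_le _ (Y (n + 1) (kf t n / 2 ^ n)) _
    _ ≤ _ := by linarith

theorem rho_lt_one (hε : 0 < ε) (h1 : 2 * ε ≤ θ) : (2:ℝ) ^ (-(θ - ε)) < 1 :=
  Real.rpow_lt_one_of_one_lt_of_neg (by norm_num) (by linarith)

theorem seq_conv (hY : GoodSeq Y θ ε q n0 N) (hε : 0 < ε) (h1 : 2 * ε ≤ θ) (h2 : θ ≤ 1 - ε)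
    {t : ℝ} (ht : |t| ≤ q - 1) :
    ∃ l, Tendsto (fun n => Y n (kf t n / 2 ^ n)) atTop (𝓝 l) := by
  have := cauchySeq_of_le_geometric ((2:ℝ) ^ (-(θ - ε))) (3 * ((2:ℝ) ^ (-(θ - ε))) ^ n0)
    (rho_lt_one hε h1) (f := fun m => Y (m + n0) (kf t (m + n0) / 2 ^ (m + n0))) (by
      intro m
      rw [dist_comm, Real.dist_eq, mul_assoc, ← pow_add, add_comm n0 m,
        show m + 1 + n0 = m + n0 + 1 by omega]
      exact seq_step hY hε h1 h2 ht (by omega))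
  obtain ⟨l, hl⟩ := cauchySeq_tendsto_of_complete this
  exact ⟨l, (tendsto_add_atTop_iff_nat n0).1 hl⟩

theorem seq_rate (hY : GoodSeq Y θ ε q n0 N) (hε : 0 < ε) (h1 : 2 * ε ≤ θ) (h2 : θ ≤ 1 - ε)
    {t l : ℝ} (ht : |t| ≤ q - 1) (hl : Tendsto (fun n => Y n (kf t n / 2 ^ n)) atTop (𝓝 l))
    {n : ℕ} (hn : n0 ≤ n) :
    |Y n (kf t n / 2 ^ n) - l|
      ≤ 3 / (1 - (2:ℝ) ^ (-(θ - ε))) * ((2:ℝ) ^ (-(θ - ε))) ^ n := by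
  have hl' := (tendsto_add_atTop_iff_nat n).2 hl
  have := dist_le_of_le_geometric_of_tendsto₀ ((2:ℝ) ^ (-(θ - ε))) (3 * ((2:ℝ) ^ (-(θ - ε))) ^ n)
    (rho_lt_one hε h1) (f := fun m => Y (m + n) (kf t (m + n) / 2 ^ (m + n))) (by
      intro m
      rw [dist_comm, Real.dist_eq, mul_assoc, ← pow_add, add_comm n m,
        show m + 1 + n = m + n + 1 by omega]
      exact seq_step hY hε h1 h2 ht (by omega)) hl'
  rw [Real.dist_eq] at this
  simp only [zero_add] at this
  rw [div_mul_eq_mul_div]; exact this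

theorem kf_grid (k : ℤ) (n m : ℕ) : (kf ((k:ℝ) / 2 ^ n) (m + n) : ℝ) / 2 ^ (m + n) = k / 2 ^ n := by
  have : kf ((k:ℝ) / 2 ^ n) (m + n) = 2 ^ m * k := by
    unfold kf
    have : (2:ℝ) ^ (m + n) * (k / 2 ^ n) = ((2 ^ m * k : ℤ) : ℝ) := by
      push_cast; rw [pow_add]; field_simp
    rw [this, Int.floor_intCast]
  rw [this]; push_cast; rw [pow_add]; field_simp

theorem seq_grid (hY : GoodSeq Y θ ε q n0 N) {k : ℤ} {n : ℕ} (hn : n0 ≤ n)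
    (hk : |k| ≤ q * 2 ^ n) {l : ℝ}
    (hl : Tendsto (fun m => Y m (kf ((k:ℝ) / 2 ^ n) m / 2 ^ m)) atTop (𝓝 l)) :
    |Y n (k / 2 ^ n) - l| ≤ 4 / 3 * (1 / 4 : ℝ) ^ n := by
  have hl' := (tendsto_add_atTop_iff_nat n).2 hl
  simp only [kf_grid] at hl'
  have := dist_le_of_le_geometric_of_tendsto₀ (1 / 4 : ℝ) ((1 / 4 : ℝ) ^ n)
    (by norm_num) (f := fun m => Y (m + n) (k / 2 ^ n)) (by
      intro m
      rw [dist_comm, Real.dist_eq, ← pow_add, add_comm n m,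
        show m + 1 + n = m + n + 1 by omega]
      have hk' : |2 ^ m * k| ≤ q * 2 ^ (m + n) := by
        rw [abs_mul, abs_of_nonneg (by positivity), pow_add]
        have : (0:ℤ) ≤ 2 ^ m := by positivity
        nlinarith
      have h := hY.param (m + n) (by omega) _ hk'
      have e : ((2 ^ m * k : ℤ) : ℝ) / 2 ^ (m + n) = k / 2 ^ n := by
        push_cast; rw [pow_add]; field_simp
      rwa [e] at h) hl'
  rw [Real.dist_eq] at this
  simp only [zero_add] at this
  refine this.trans (le_of_eq ?_)
  ring

theorem seq_holder (hY : GoodSeq Y θ ε q n0 N) (hε : 0 < ε) (h1 : 2 * ε ≤ θ) (h2 : θ ≤ 1 - ε)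
    {L : ℝ → ℝ} (hL : ∀ t : ℝ, |t| ≤ q - 1 →
      Tendsto (fun n => Y n (kf t n / 2 ^ n)) atTop (𝓝 (L t))) :
    ∃ C : ℝ, ∀ t s : ℝ, |t| ≤ q - 1 → |s| ≤ q - 1 → t ≠ s → |t - s| < (1 / 2) ^ n0 →
      |L t - L s| ≤ C * |t - s| ^ (θ - ε) := by
  set ρ := (2:ℝ) ^ (-(θ - ε)) with hρ
  have hρ0 : 0 < ρ := by positivity
  have hρ1 : ρ < 1 := rho_lt_one hε h1
  have hρ2 : 0 < 3 / (1 - ρ) := div_pos (by norm_num) (by linarith)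
  refine ⟨(2 * (3 / (1 - ρ)) + 2) * 2, fun t s ht hs hts hd => ?_⟩
  have hpos : 0 < |t - s| := abs_pos.2 (sub_ne_zero.2 hts)
  obtain ⟨n, hn1, hn2⟩ := exists_nat_pow_near_of_lt_one hpos
    (hd.le.trans (pow_le_one₀ (by norm_num) (by norm_num))) (by norm_num : (0:ℝ) < 1/2)
    (by norm_num)
  have hn : n0 ≤ n := by
    by_contra hcon
    have : (1/2 : ℝ) ^ n0 ≤ (1/2) ^ (n + 1) :=
      pow_le_pow_of_le_one (by norm_num) (by norm_num) (by omega)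
    linarith
  have ha := seq_rate hY hε h1 h2 ht (hL t ht) hn
  have hb := seq_rate hY hε h1 h2 hs (hL s hs) hn
  have hmid : |Y n (kf t n / 2 ^ n) - Y n (kf s n / 2 ^ n)| ≤ 2 * ρ ^ n := by
    have h2n : (0:ℝ) < 2 ^ n := by positivity
    have hh : |(2:ℝ) ^ n * t - 2 ^ n * s| ≤ 1 := by
      rw [← mul_sub, abs_mul, abs_of_pos h2n]
      calc (2:ℝ) ^ n * |t - s| ≤ 2 ^ n * (1 / 2) ^ n := by gcongr
        _ = 1 := by rw [← mul_pow]; norm_num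
    have main : ∀ u v : ℝ, |u| ≤ q - 1 → u ≤ v → |(2:ℝ) ^ n * u - 2 ^ n * v| ≤ 1 →
        |Y n (kf v n / 2 ^ n) - Y n (kf u n / 2 ^ n)| ≤ 2 * ρ ^ n := by
      intro u v hu huv h
      have h3 : kf u n ≤ kf v n := Int.floor_le_floor (by gcongr)
      have h4 : kf v n < kf u n + 2 := by
        unfold kf
        rw [Int.floor_lt]
        push_cast
        have := Int.lt_floor_add_one ((2:ℝ) ^ n * u)
        have := (abs_le.1 h).1
        linarith
      have h5 : kf v n = kf u n ∨ kf v n = kf u n + 1 := by omega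
      rcases h5 with h5 | h5
      · rw [h5, sub_self, abs_zero]; positivity
      · rw [h5, Int.cast_add, Int.cast_one]
        exact hY.incr n hn _ (kf_abs_le hu n)
    rcases le_total s t with h | h
    · exact main s t hs h (by rwa [abs_sub_comm])
    · rw [abs_sub_comm]; exact main t s ht h hh
  have hfin : |L t - L s| ≤ (2 * (3 / (1 - ρ)) + 2) * ρ ^ n := by
    have e : L t - L s = -(Y n (kf t n / 2 ^ n) - L t) + (Y n (kf t n / 2 ^ n) - Y n (kf s n / 2 ^ n))
      + (Y n (kf s n / 2 ^ n) - L s) := by ring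
    rw [e]
    refine (abs_add_three _ _ _).trans ?_
    rw [abs_neg]
    rw [← hρ] at ha hb
    linarith
  refine hfin.trans ?_
  rw [mul_assoc]
  gcongr
  have e : ρ ^ n = ((1/2 : ℝ) ^ n) ^ (θ - ε) := by
    rw [hρ, ← Real.rpow_natCast, ← Real.rpow_natCast, ← Real.rpow_mul (by norm_num),
      ← Real.rpow_mul (by norm_num), one_div, Real.inv_rpow (by norm_num),
      ← Real.rpow_neg (by norm_num)]
    congr 1; ring
  rw [e]
  calc ((1/2 : ℝ) ^ n) ^ (θ - ε) ≤ (2 * |t - s|) ^ (θ - ε) := by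
        apply Real.rpow_le_rpow (by positivity) _ (by linarith)
        rw [pow_succ] at hn1; linarith
    _ = 2 ^ (θ - ε) * |t - s| ^ (θ - ε) := Real.mul_rpow (by norm_num) (by positivity)
    _ ≤ 2 ^ (1:ℝ) * |t - s| ^ (θ - ε) := by
        gcongr
        · norm_num
        · linarith
    _ = _ := by rw [Real.rpow_one]

theorem seq_osc (hY : GoodSeq Y θ ε q n0 N) (hε : 0 < ε) (h1 : 2 * ε ≤ θ) (h2 : θ ≤ 1 - ε)
    {L : ℝ → ℝ} (hL : ∀ t : ℝ, |t| ≤ q - 1 →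
      Tendsto (fun n => Y n (kf t n / 2 ^ n)) atTop (𝓝 (L t)))
    {s α δ : ℝ} (hs : |s| ≤ q - 2) (hα : θ + ε < α) (hδ : 0 < δ)
    (hb : ∀ h, |h| < δ → |L (s + h) - L s| ≤ |h| ^ α) : False := by
  have hα0 : 0 < α := by linarith
  have hbound : ∀ᶠ n : ℕ in atTop, (2:ℝ) ^ (-(n:ℝ) * (θ + ε)) ≤
      8 / 3 * (1 / 4 : ℝ) ^ n + 2 * ((N + 1) * (1 / 2 : ℝ) ^ n) ^ α := by
    have hlim : Tendsto (fun n : ℕ => ((N:ℝ) + 1) * (1 / 2 : ℝ) ^ n) atTop (𝓝 0) := by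
      have := (tendsto_pow_atTop_nhds_zero_of_lt_one (by norm_num : (0:ℝ) ≤ 1/2)
        (by norm_num)).const_mul ((N:ℝ) + 1)
      simpa using this
    filter_upwards [hlim.eventually_lt_const hδ, hlim.eventually_lt_const zero_lt_one,
      eventually_ge_atTop n0] with n hnδ hn1 hn
    have h2n : (0:ℝ) < 2 ^ n := by positivity
    have hfl1 := Int.floor_le ((2:ℝ) ^ n * s)
    have hfl2 := Int.lt_floor_add_one ((2:ℝ) ^ n * s)
    have hq1 : |s| ≤ q - 1 := by linarith
    obtain ⟨i, hi, hosc⟩ := hY.osc n hn (kf s n) (kf_abs_le hq1 n)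
    have hclose : ∀ p : ℕ, p ≤ N → |((kf s n : ℝ) + p) / 2 ^ n - s| ≤ (N + 1) * (1/2) ^ n := by
      intro p hp
      have hp' : (p:ℝ) ≤ N := by exact_mod_cast hp
      have hp0 : (0:ℝ) ≤ p := by positivity
      have e : ((kf s n : ℝ) + p) / 2 ^ n - s = ((kf s n : ℝ) + p - 2 ^ n * s) * (1/2) ^ n := by
        rw [one_div, inv_pow]; field_simp
      rw [e, abs_mul, abs_of_pos (by positivity : (0:ℝ) < (1/2) ^ n)]
      gcongr
      unfold kf
      rw [abs_le]
      constructor <;> linarith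
    have hpt : ∀ p : ℕ, p ≤ N → |Y n (((kf s n : ℝ) + p) / 2 ^ n) - L (((kf s n : ℝ) + p) / 2 ^ n)|
        ≤ 4 / 3 * (1 / 4) ^ n ∧
        |L (((kf s n : ℝ) + p) / 2 ^ n) - L s| ≤ ((N + 1) * (1 / 2 : ℝ) ^ n) ^ α := by
      intro p hp
      have hc := hclose p hp
      have hc1 : |((kf s n : ℝ) + p) / 2 ^ n| ≤ q - 1 := by
        have := abs_sub_abs_le_abs_sub (((kf s n : ℝ) + p) / 2 ^ n) s
        linarith
      have e : ((kf s n : ℝ) + p) = ((kf s n + p : ℤ) : ℝ) := by push_cast; ring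
      constructor
      · have hlm := hL _ hc1
        rw [e] at hlm hc1 ⊢
        refine seq_grid hY hn ?_ hlm
        rw [abs_div, abs_of_pos h2n, div_le_iff₀ h2n] at hc1
        have : |((kf s n + p : ℤ) : ℝ)| ≤ q * 2 ^ n := by nlinarith
        exact_mod_cast this
      · have := hb (((kf s n : ℝ) + p) / 2 ^ n - s) (hc.trans_lt hnδ)
        rw [add_sub_cancel] at this
        exact this.trans (Real.rpow_le_rpow (abs_nonneg _) hc hα0.le)
    obtain ⟨ha1, ha2⟩ := hpt i hi.le
    obtain ⟨hb1, hb2⟩ := hpt (i + 1) hi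
    set A := Y n (((kf s n : ℝ) + (i + 1 : ℕ)) / 2 ^ n)
    set A' := L (((kf s n : ℝ) + (i + 1 : ℕ)) / 2 ^ n)
    set D := Y n (((kf s n : ℝ) + i) / 2 ^ n)
    set D' := L (((kf s n : ℝ) + i) / 2 ^ n)
    have : |A - D| ≤ |A - A'| + |A' - L s| + |D' - L s| + |D - D'| := by
      have e : A - D = (A - A') + (A' - L s) + (-(D' - L s)) + (-(D - D')) := by ring
      rw [e]
      refine (abs_add_le _ _).trans ?_
      rw [abs_neg]
      have := abs_add_three (A - A') (A' - L s) (-(D' - L s))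
      rw [abs_neg] at this
      linarith
    linarith
  have hlim2 : Tendsto (fun n : ℕ => 8 / 3 * ((1 / 4 : ℝ) * 2 ^ (θ + ε)) ^ n +
      2 * (N + 1) ^ α * ((1 / 2 : ℝ) ^ α * 2 ^ (θ + ε)) ^ n) atTop (𝓝 (8 / 3 * 0 +
      2 * (N + 1) ^ α * 0)) := by
    have hh : (1/2 : ℝ) ^ α * 2 ^ (θ + ε) < 1 := by
      rw [one_div, Real.inv_rpow (by norm_num), ← Real.rpow_neg (by norm_num),
        ← Real.rpow_add (by norm_num)]
      exact Real.rpow_lt_one_of_one_lt_of_neg (by norm_num) (by linarith)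
    have hh' : (1/4 : ℝ) * 2 ^ (θ + ε) < 1 := by
      have : (2:ℝ) ^ (θ + ε) ≤ 2 ^ (1:ℝ) :=
        Real.rpow_le_rpow_of_exponent_le (by norm_num) (by linarith)
      rw [Real.rpow_one] at this
      linarith
    exact ((tendsto_pow_atTop_nhds_zero_of_lt_one (by positivity) hh').const_mul _).add
      ((tendsto_pow_atTop_nhds_zero_of_lt_one (by positivity) hh).const_mul _)
  simp only [mul_zero, add_zero] at hlim2
  obtain ⟨n, hn1, hn2⟩ := (hbound.and (hlim2.eventually_lt_const zero_lt_one)).exists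
  have e1 : (2:ℝ) ^ (-(n:ℝ) * (θ + ε)) * (2 ^ (θ + ε)) ^ n = 1 := by
    rw [← Real.rpow_natCast, ← Real.rpow_mul (by norm_num), ← Real.rpow_add (by norm_num)]
    ring_nf
    exact Real.rpow_zero 2
  have e2 : (((N:ℝ) + 1) * (1 / 2 : ℝ) ^ n) ^ α = (N + 1) ^ α * ((1/2 : ℝ) ^ α) ^ n := by
    rw [Real.mul_rpow (by positivity) (by positivity), ← Real.rpow_natCast, ← Real.rpow_natCast,
      ← Real.rpow_mul (by norm_num), ← Real.rpow_mul (by norm_num), mul_comm (n:ℝ)]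
  have h3 := mul_le_mul_of_nonneg_right hn1 (by positivity : (0:ℝ) ≤ (2 ^ (θ + ε)) ^ n)
  rw [e1, e2] at h3
  rw [mul_pow, mul_pow] at hn2
  nlinarith

end pathwise

section assembly

/-- The limiting field. -/
def limField (X : ℝ → ℝ → ℝ) (θ t : ℝ) : ℝ :=
  limUnder atTop (fun n : ℕ => X ((jf θ n : ℝ) / 8 ^ n) ((kf t n : ℝ) / 2 ^ n))

theorem exists_stage {θ : ℝ} (hθ : θ ∈ Ioo (0:ℝ) 1) (s : ℝ) {η : ℝ} (hη : 0 < η) :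
    ∃ q : ℕ, cq q < η ∧ 2 * cq q ≤ θ ∧ θ ≤ 1 - cq q ∧ |s| ≤ q - 2 := by
  have hlim : Tendsto cq atTop (𝓝 0) := by
    have h : Tendsto (fun q : ℕ => ((q:ℝ) + 3)) atTop atTop :=
      tendsto_atTop_add_const_right _ _ tendsto_natCast_atTop_atTop
    have := h.inv_tendsto_atTop
    refine this.congr fun q => ?_
    unfold cq
    simp
  have h1 := hlim.eventually_lt_const hη
  have h2 := hlim.eventually_lt_const (half_pos hθ.1)
  have h3 := hlim.eventually_lt_const (sub_pos.2 hθ.2)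
  have h4 : ∀ᶠ q : ℕ in atTop, |s| + 2 ≤ q :=
    tendsto_natCast_atTop_atTop.eventually_ge_atTop (|s| + 2)
  obtain ⟨q, a1, a2, a3, a4⟩ := (h1.and (h2.and (h3.and h4))).exists
  exact ⟨q, a1, by linarith, by linarith, by linarith⟩

theorem limField_tendsto {X : ℝ → ℝ → ℝ} (hX : ∀ q, GoodPath X q) {θ : ℝ}
    (hθ : θ ∈ Ioo (0:ℝ) 1) (t : ℝ) :
    Tendsto (fun n : ℕ => X ((jf θ n : ℝ) / 8 ^ n) ((kf t n : ℝ) / 2 ^ n)) atTop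
      (𝓝 (limField X θ t)) := by
  obtain ⟨q, -, h1, h2, h3⟩ := exists_stage hθ t one_pos
  obtain ⟨n0, N, hY⟩ := goodSeq_of_goodPath (hX q) h1 h2
  exact tendsto_nhds_limUnder (seq_conv hY (cq_pos q) h1 h2 (by linarith))

theorem limField_holder {X : ℝ → ℝ → ℝ} (hX : ∀ q, GoodPath X q) {θ : ℝ}
    (hθ : θ ∈ Ioo (0:ℝ) 1) (s : ℝ) : pointwiseHolderExp (fun t => limField X θ t) s = θ := by
  have hmem : ∀ α, 0 ≤ α → α < θ → α ∈ {α : ℝ | 0 ≤ α ∧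
      Filter.Tendsto (fun h : ℝ => |limField X θ (s + h) - limField X θ s| / |h| ^ α)
        (𝓝[≠] 0) (𝓝 0)} := by
    intro α h0 hα
    refine ⟨h0, ?_⟩
    obtain ⟨q, h4, h1, h2, h3⟩ := exists_stage hθ s (sub_pos.2 hα)
    obtain ⟨n0, N, hY⟩ := goodSeq_of_goodPath (hX q) h1 h2
    obtain ⟨C, hC⟩ := seq_holder hY (cq_pos q) h1 h2 (L := limField X θ)
      (fun t _ => limField_tendsto hX hθ t)
    have hlim : Tendsto (fun h : ℝ => C * |h| ^ (θ - cq q - α)) (𝓝[≠] 0) (𝓝 0) := by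
      have hc : ContinuousAt (fun h : ℝ => C * |h| ^ (θ - cq q - α)) 0 := by
        refine continuousAt_const.mul (ContinuousAt.rpow_const continuous_abs.continuousAt ?_)
        right; linarith
      have := hc.tendsto
      simp only [abs_zero] at this
      rw [Real.zero_rpow (by linarith), mul_zero] at this
      exact this.mono_left nhdsWithin_le_nhds
    have hsmall : ∀ᶠ h : ℝ in 𝓝[≠] 0, |h| < (1/2) ^ n0 := by
      refine nhdsWithin_le_nhds ?_
      have : Tendsto (fun h : ℝ => |h|) (𝓝 0) (𝓝 0) := by
        simpa using (continuous_abs (G := ℝ)).tendsto 0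
      exact this.eventually_lt_const (by positivity)
    refine squeeze_zero' (Eventually.of_forall fun h => by positivity) ?_ hlim
    filter_upwards [hsmall, self_mem_nhdsWithin] with h hh hne
    have hne' : h ≠ 0 := hne
    have hp : 0 < |h| := abs_pos.2 hne'
    have hh1 : |h| < 1 := hh.trans_le (pow_le_one₀ (by norm_num) (by norm_num))
    have h5 := hC (s + h) s ((abs_add_le s h).trans (by linarith)) (by linarith)
      (by simpa using hne') (by simpa using hh)
    rw [add_sub_cancel_left] at h5
    rw [div_le_iff₀ (by positivity), mul_assoc, ← Real.rpow_add hp, sub_add_cancel]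
    exact h5
  refine csSup_eq_of_forall_le_of_forall_lt_exists_gt ⟨0, hmem 0 le_rfl hθ.1⟩ ?_ ?_
  · rintro α ⟨-, hα⟩
    by_contra hcon
    have hlt := not_le.1 hcon
    obtain ⟨q, h4, h1, h2, h3⟩ := exists_stage hθ s (sub_pos.2 hlt)
    obtain ⟨n0, N, hY⟩ := goodSeq_of_goodPath (hX q) h1 h2
    have hev := hα.eventually_lt_const zero_lt_one
    rw [eventually_nhdsWithin_iff, Metric.eventually_nhds_iff] at hev
    obtain ⟨δ, hδ, hb⟩ := hev
    refine seq_osc hY (cq_pos q) h1 h2 (L := limField X θ)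
      (fun t _ => limField_tendsto hX hθ t) h3 (by linarith : θ + cq q < α) hδ ?_
    intro h hh
    by_cases h0 : h = 0
    · subst h0
      rw [add_zero, sub_self, abs_zero]
      exact Real.rpow_nonneg le_rfl _
    · have := hb (y := h) (by simpa using hh) h0
      rw [div_lt_one (Real.rpow_pos_of_pos (abs_pos.2 h0) _)] at this
      exact this.le
  · intro w hw
    have : max w 0 < θ := max_lt hw hθ.1
    exact ⟨(max w 0 + θ) / 2, hmem _ (by have := le_max_right w 0; linarith [hθ.1]) (by linarith),
      by have := le_max_left w 0; linarith⟩

theorem kap_approx_tendsto {θ : ℝ} (hθ : θ ∈ Ioo (0:ℝ) 1) (t : ℝ) :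
    Tendsto (fun n : ℕ => kap ((jf θ n : ℝ) / 8 ^ n) ((kf t n : ℝ) / 2 ^ n)) atTop
      (𝓝 (kap θ t)) := by
  obtain ⟨q, -, h1, h2, h3⟩ := exists_stage hθ t one_pos
  have hc := cq_pos q
  obtain ⟨C, hC, hK⟩ := kap_time (cq_pos q) (cq_lt q)
  have hq0 : (0:ℝ) ≤ q := by positivity
  obtain ⟨C', hC', hK'⟩ := kap_param (T := q + 1) (cq_pos q) (cq_lt q) (by linarith)
  rw [tendsto_iff_norm_sub_tendsto_zero]
  have h8 : Tendsto (fun n : ℕ => (1 / 8 : ℝ) ^ n) atTop (𝓝 0) :=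
    tendsto_pow_atTop_nhds_zero_of_lt_one (by norm_num) (by norm_num)
  have h2' : Tendsto (fun n : ℕ => ((1 / 2 : ℝ) ^ n) ^ θ) atTop (𝓝 0) := by
    have : Tendsto (fun n : ℕ => (1 / 2 : ℝ) ^ n) atTop (𝓝 0) :=
      tendsto_pow_atTop_nhds_zero_of_lt_one (by norm_num) (by norm_num)
    have h := this.rpow_const (p := θ) (Or.inr hθ.1.le)
    rwa [Real.zero_rpow hθ.1.ne'] at h
  have hlim : Tendsto (fun n : ℕ => C' * (1 / 8 : ℝ) ^ n + C * ((1 / 2 : ℝ) ^ n) ^ θ) atTop (𝓝 0) := by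
    simpa using (h8.const_mul C').add (h2'.const_mul C)
  refine squeeze_zero' (Eventually.of_forall fun n => norm_nonneg _) ?_ hlim
  filter_upwards [h8.eventually_lt_const hc] with n hn
  have hmem : (jf θ n : ℝ) / 8 ^ n ∈ Icc (cq q) (1 - cq q) :=
    ⟨by linarith [le_jf θ n], (jf_le hθ.1 n).trans h2⟩
  have hθm : θ ∈ Icc (cq q) (1 - cq q) := ⟨by linarith, h2⟩
  have h2n : (0:ℝ) < 2 ^ n := by positivity
  have hk := kf_abs_le (t := t) (q := q) (by linarith) n
  have hkm : (kf t n / 2 ^ n : ℝ) ∈ Icc (-((q:ℝ) + 1)) (q + 1) := by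
    have h1 : |(kf t n:ℝ)| ≤ q * 2 ^ n := by exact_mod_cast hk
    obtain ⟨h2, h3⟩ := abs_le.1 h1
    constructor
    · rw [le_div_iff₀ h2n]; nlinarith
    · rw [div_le_iff₀ h2n]; nlinarith
  have ha := hK' _ hmem _ hθm _ hkm
  have hb := hK _ hθm (kf t n / 2 ^ n) t
  have ha' : |(jf θ n : ℝ) / 8 ^ n - θ| ≤ (1 / 8) ^ n := by
    rw [abs_le]
    have := jf_le hθ.1 n
    have := le_jf θ n
    have : (0:ℝ) < (1/8) ^ n := by positivity
    constructor <;> linarith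
  have hb' : |(kf t n : ℝ) / 2 ^ n - t| ≤ (1 / 2) ^ n := by
    have e : (kf t n : ℝ) / 2 ^ n - t = (kf t n - 2 ^ n * t) * (1/2) ^ n := by
      rw [one_div, inv_pow]; field_simp
    rw [e, abs_mul, abs_of_pos (by positivity : (0:ℝ) < (1/2) ^ n)]
    refine mul_le_of_le_one_left (by positivity) ?_
    have hfl1 := Int.floor_le ((2:ℝ) ^ n * t)
    have hfl2 := Int.lt_floor_add_one ((2:ℝ) ^ n * t)
    unfold kf
    rw [abs_le]
    constructor <;> linarith
  calc _ ≤ ‖kap ((jf θ n : ℝ) / 8 ^ n) ((kf t n : ℝ) / 2 ^ n) - kap θ ((kf t n : ℝ) / 2 ^ n)‖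
        + ‖kap θ ((kf t n : ℝ) / 2 ^ n) - kap θ t‖ := norm_sub_le_norm_sub_add_norm_sub _ _ _
    _ ≤ C' * |(jf θ n : ℝ) / 8 ^ n - θ| + C * |(kf t n : ℝ) / 2 ^ n - t| ^ θ := add_le_add ha hb
    _ ≤ _ := by
      refine add_le_add (mul_le_mul_of_nonneg_left ha' hC'.le) (mul_le_mul_of_nonneg_left ?_ hC.le)
      exact Real.rpow_le_rpow (abs_nonneg _) hb' hθ.1.le

theorem limField_ae_eq {Ω : Type} {mΩ : MeasurableSpace Ω} {P : Measure Ω} [IsProbabilityMeasure P]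
    (W : Lp ℝ 2 (volume : Measure ℝ) →ₗᵢ[ℝ] Lp ℝ 2 P)
    (hW : ∀ f, P.map (W f) = gaussianReal 0 (‖f‖₊ ^ 2)) {θ : ℝ} (hθ : θ ∈ Ioo (0:ℝ) 1) (t : ℝ) :
    (fun ω => limField (fun θ t => W (kap θ t) ω) θ t) =ᵐ[P] W (kap θ t) := by
  have h1 : Tendsto (fun n : ℕ => W (kap ((jf θ n : ℝ) / 8 ^ n) ((kf t n : ℝ) / 2 ^ n))) atTop
      (𝓝 (W (kap θ t))) := (W.continuous.tendsto _).comp (kap_approx_tendsto hθ t)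
  have h2 := tendstoInMeasure_of_tendsto_Lp h1
  obtain ⟨ns, hns, h3⟩ := h2.exists_seq_tendsto_ae
  filter_upwards [h3, ae_goodPath W hW] with ω h4 h5
  exact tendsto_nhds_unique ((limField_tendsto h5 hθ t).comp hns.tendsto_atTop) h4

end assembly

/-- There exist a centered Gaussian field `B̃` with the multifractional covariance and
an event `Ω*` of probability 1, not depending on `s` and `θ`, on which the pointwise
Hölder exponent at every `s` of every fractional Brownian motion `t ↦ B̃(t,θ,ω)`
equals its Hurst parameter `θ`. -/
theorem exists_fbm_field_with_uniform_pointwise_holder_exponent :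
    ∃ (Ω : Type) (mΩ : MeasurableSpace Ω) (P : @MeasureTheory.Measure Ω mΩ),
      @IsProbabilityMeasure Ω mΩ P ∧
      ∃ B : ℝ → ℝ → Ω → ℝ,
        -- centered Gaussian field
        (∀ (n : ℕ) (t θ : Fin n → ℝ), (∀ i, θ i ∈ Set.Ioo (0:ℝ) 1) →
          ∀ c : Fin n → ℝ, ∃ v : NNReal,
            @Measure.map Ω ℝ mΩ _ (fun ω => ∑ i, c i * B (t i) (θ i) ω) P
              = gaussianReal 0 v) ∧
        -- covariance
        (∀ (t θ t' θ' : ℝ), θ ∈ Set.Ioo (0:ℝ) 1 → θ' ∈ Set.Ioo (0:ℝ) 1 →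
          (∫ ω, B t θ ω * B t' θ' ω ∂P)
            = ∫ x : ℝ, fbmKernel θ t x * fbmKernel θ' t' x) ∧
        -- the full event on which all pointwise Hölder exponents equal θ
        ∃ Ωstar : Set Ω, MeasurableSet Ωstar ∧ P Ωstar = 1 ∧
          ∀ ω ∈ Ωstar, ∀ s : ℝ, ∀ θ ∈ Set.Ioo (0:ℝ) 1,
            pointwiseHolderExp (fun t => B t θ ω) s = θ := by
  obtain ⟨Ω, mΩ, P, hP, W, hW⟩ := exists_isonormal (Lp ℝ 2 (volume : Measure ℝ))
  refine ⟨Ω, mΩ, P, hP, fun t θ ω => limField (fun θ t => W (kap θ t) ω) θ t, ?_, ?_, ?_⟩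
  · intro n t θ hθ c
    refine ⟨‖∑ i, c i • kap (θ i) (t i)‖₊ ^ 2, ?_⟩
    rw [← hW]
    refine Measure.map_congr ?_
    have h1 : ∀ᵐ ω ∂P, ∀ i, limField (fun θ t => W (kap θ t) ω) (θ i) (t i)
        = W (kap (θ i) (t i)) ω := ae_all_iff.2 fun i => limField_ae_eq W hW (hθ i) (t i)
    filter_upwards [h1, isonormal_linComb W Finset.univ c (fun i => kap (θ i) (t i))] with ω h2 h3
    rw [h3]
    exact Finset.sum_congr rfl fun i _ => by rw [h2 i]
  · intro t θ t' θ' hθ hθ'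
    rw [← inner_kap hθ hθ', ← isonormal_inner W]
    refine integral_congr_ae ?_
    filter_upwards [limField_ae_eq W hW hθ t, limField_ae_eq W hW hθ' t'] with ω h1 h2
    rw [h1, h2]
  · have hgood := ae_goodPath W hW
    rw [ae_iff] at hgood
    refine ⟨(toMeasurable P {ω | ¬ ∀ q, GoodPath (fun θ t => W (kap θ t) ω) q})ᶜ,
      (measurableSet_toMeasurable _ _).compl, ?_, ?_⟩
    · rw [prob_compl_eq_one_iff (measurableSet_toMeasurable _ _), measure_toMeasurable, hgood]
    · intro ω hω s θ hθ
      have h1 : ∀ q, GoodPath (fun θ t => W (kap θ t) ω) q := by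
        by_contra hcon
        exact hω (subset_toMeasurable _ _ hcon)
      exact limField_holder h1 hθ s

end
end

section
/- Let F : ℝ × (0,1) → ℝ be a function satisfying: (a) for every (s,θ) ∈ ℝ × (0,1) and every ε > 0, limsup_{h→0} |F(s+h,θ) − F(s,θ)| / |h|^{θ−ε} = 0 and limsup_{h→0} |F(s+h,θ) − F(s,θ)| / |h|^{θ+ε} = +∞; (b) for each fixed t ∈ ℝ, θ ↦ F(t,θ) is C^∞ on (0,1), with n-th derivative ∂_θⁿF(t,θ); (c) for every n ∈ ℕ, ε > 0, M > 0 and 0 < a < b < 1, there exists C > 0 such that |∂_θⁿF(t₁,θ₁) − ∂_θⁿF(t₂,θ₂)| ≤ C( |t₁−t₂|^{max{θ₁,θ₂}−ε} + |θ₁−θ₂| ) for all (t₁,θ₁),(t₂,θ₂) ∈ [−M,M] × [a,b]. Let H : ℝ → (0,1) be continuous and let J ⊆ (0,+∞) be a nonempty open interval on which α_H(s) < H(s) < 2α_H(s) for every s ∈ J, where α_H(s) is the pointwise Hölder exponent of H at s. Define X(t) = F(t,H(t)). Then for every s ∈ J: if ∂_θF(s,H(s)) ≠ 0 then the pointwise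 Hölder exponent of X at s equals α_H(s); and if ∂_θF(s,H(s)) = 0 then the pointwise Hölder exponent of X at s equals H(s). -/
open MeasureTheory Filter Set Topology

noncomputable section

/-- Little-o form of the Hölder condition. -/
def HolderLO (f : ℝ → ℝ) (s α : ℝ) : Prop :=
  (fun h : ℝ => f (s + h) - f s) =o[𝓝[≠] 0] (fun h : ℝ => |h| ^ α)

theorem holderLO_iff (f : ℝ → ℝ) (s α : ℝ) : HolderLO f s α ↔
    Filter.Tendsto (fun h : ℝ => |f (s + h) - f s| / |h| ^ α) (𝓝[≠] 0) (𝓝 0) := by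
  unfold HolderLO
  rw [← Asymptotics.isLittleO_norm_left, Asymptotics.isLittleO_iff_tendsto']
  · simp only [Real.norm_eq_abs]
  · filter_upwards [self_mem_nhdsWithin] with h hh h0
    have : 0 < |h| ^ α := Real.rpow_pos_of_pos (abs_pos.mpr hh) α
    exact absurd h0 this.ne'

theorem pow_isBigO {a b : ℝ} (hab : a ≤ b) :
    (fun h : ℝ => |h| ^ b) =O[𝓝[≠] 0] (fun h : ℝ => |h| ^ a) := by
  apply Asymptotics.IsBigO.of_bound 1
  have h1 : ∀ᶠ h : ℝ in 𝓝[≠] 0, h ∈ Metric.ball (0:ℝ) 1 :=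
    mem_nhdsWithin_of_mem_nhds (Metric.ball_mem_nhds 0 one_pos)
  filter_upwards [self_mem_nhdsWithin, h1] with h hh h1
  have hp : 0 < |h| := abs_pos.mpr hh
  have hl : |h| < 1 := by simpa using h1
  rw [one_mul, Real.norm_of_nonneg (by positivity), Real.norm_of_nonneg (by positivity)]
  exact Real.rpow_le_rpow_of_exponent_ge hp hl.le hab

theorem exp_eq {f : ℝ → ℝ} {s x : ℝ} (hx : 0 < x) (h1 : ∀ β, β < x → HolderLO f s β)
    (h2 : ∀ β, x < β → ¬ HolderLO f s β) : pointwiseHolderExp f s = x := by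
  unfold pointwiseHolderExp
  simp only [← holderLO_iff]
  apply csSup_eq_of_forall_le_of_forall_lt_exists_gt
  · exact ⟨0, le_rfl, h1 0 hx⟩
  · rintro β ⟨_, hβ⟩
    by_contra hlt
    exact h2 β (not_le.mp hlt) hβ
  · intro w hw
    have : max w 0 < x := max_lt hw hx
    refine ⟨(max w 0 + x) / 2, ⟨?_, h1 _ (by linarith)⟩, ?_⟩
    · have := le_max_right w 0
      linarith
    · have := le_max_left w 0
      linarith

theorem exp_spec {f : ℝ → ℝ} {s : ℝ} (hx : 0 < pointwiseHolderExp f s) :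
    (∀ β, β < pointwiseHolderExp f s → HolderLO f s β) ∧
    (∀ β, pointwiseHolderExp f s < β → ¬ HolderLO f s β) := by
  unfold pointwiseHolderExp at *
  simp only [← holderLO_iff] at *
  set S := {α : ℝ | 0 ≤ α ∧ HolderLO f s α} with hS
  have hb : BddAbove S := by
    by_contra h
    rw [Real.sSup_of_not_bddAbove h] at hx
    exact lt_irrefl _ hx
  have hne : S.Nonempty := by
    by_contra h
    rw [Set.not_nonempty_iff_eq_empty] at h
    rw [h, Real.sSup_empty] at hx
    exact lt_irrefl _ hx
  constructor
  · intro β hβ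
    obtain ⟨a, ha, hlt⟩ := exists_lt_of_lt_csSup hne hβ
    exact ha.2.trans_isBigO (pow_isBigO hlt.le)
  · intro β hβ h
    exact absurd (le_csSup hb (show β ∈ S from ⟨(hx.trans hβ).le, h⟩)) (not_le.mpr hβ)

theorem mv_bound (F : ℝ → ℝ → ℝ)
    (hb : ∀ t : ℝ, ContDiffOn ℝ (⊤ : ℕ∞) (fun θ => F t θ) (Set.Ioo (0:ℝ) 1))
    (t x y : ℝ) (hx : x ∈ Set.Ioo (0:ℝ) 1) (hy : y ∈ Set.Ioo (0:ℝ) 1) (D B : ℝ)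
    (hB : ∀ ξ ∈ Set.uIcc x y, |derivWithin (fun θ => F t θ) (Set.Ioo (0:ℝ) 1) ξ - D| ≤ B) :
    |F t y - F t x - D * (y - x)| ≤ B * |y - x| := by
  have hsub : Set.uIcc x y ⊆ Set.Ioo (0:ℝ) 1 := by
    intro z hz
    rw [Set.mem_uIcc] at hz
    rcases hz with h | h
    · exact ⟨hx.1.trans_le h.1, h.2.trans_lt hy.2⟩
    · exact ⟨hy.1.trans_le h.1, h.2.trans_lt hx.2⟩
  have hd : ∀ ξ ∈ Set.uIcc x y, HasDerivWithinAt (fun θ => F t θ - D * θ)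
      (derivWithin (fun θ => F t θ) (Set.Ioo (0:ℝ) 1) ξ - D) (Set.uIcc x y) ξ := by
    intro ξ hξ
    have h1 := (((hb t).differentiableOn (by simp)) ξ (hsub hξ)).hasDerivWithinAt.mono hsub
    have h2 : HasDerivWithinAt (fun θ : ℝ => D * θ) D (Set.uIcc x y) ξ := by
      simpa using (hasDerivWithinAt_id ξ (Set.uIcc x y)).const_mul D
    exact h1.sub h2
  have := (convex_uIcc x y).norm_image_sub_le_of_norm_hasDerivWithin_le hd hB
    Set.left_mem_uIcc Set.right_mem_uIcc
  simp only [Real.norm_eq_abs] at this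
  convert this using 2
  ring

theorem remainder (F : ℝ → ℝ → ℝ)
    (hb : ∀ t : ℝ, ContDiffOn ℝ (⊤ : ℕ∞) (fun θ => F t θ) (Set.Ioo (0:ℝ) 1))
    (hc : ∀ (n : ℕ) (ε M a b : ℝ), 0 < ε → 0 < M → 0 < a → a < b → b < 1 →
      ∃ C : ℝ, 0 < C ∧
        ∀ t₁ θ₁ t₂ θ₂ : ℝ, t₁ ∈ Set.Icc (-M) M → θ₁ ∈ Set.Icc a b →
          t₂ ∈ Set.Icc (-M) M → θ₂ ∈ Set.Icc a b →
          |iteratedDerivWithin n (fun θ => F t₁ θ) (Set.Ioo (0:ℝ) 1) θ₁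
            - iteratedDerivWithin n (fun θ => F t₂ θ) (Set.Ioo (0:ℝ) 1) θ₂|
            ≤ C * (|t₁ - t₂| ^ (max θ₁ θ₂ - ε) + |θ₁ - θ₂|))
    (H : ℝ → ℝ) (hHcont : Continuous H) (hHrange : ∀ s, H s ∈ Set.Ioo (0:ℝ) 1)
    (s γ : ℝ) (hγ : γ < H s) (hδ : HolderLO H s γ) :
    (fun h : ℝ => F (s + h) (H (s + h)) - F (s + h) (H s)
      - derivWithin (fun θ => F s θ) (Set.Ioo (0:ℝ) 1) (H s) * (H (s + h) - H s))
      =o[𝓝[≠] 0] (fun h : ℝ => |h| ^ (2 * γ)) := by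
  obtain ⟨h0, h1⟩ := hHrange s
  obtain ⟨C, hC, hCb⟩ := hc 1 (H s - γ) (|s| + 1) (H s / 2) ((H s + 1) / 2) (by linarith)
    (by positivity) (by linarith) (by linarith) (by linarith)
  have hbig : (fun h : ℝ => F (s + h) (H (s + h)) - F (s + h) (H s)
      - derivWithin (fun θ => F s θ) (Set.Ioo (0:ℝ) 1) (H s) * (H (s + h) - H s))
      =O[𝓝[≠] 0] (fun h : ℝ => (|h| ^ γ + |H (s + h) - H s|) * (H (s + h) - H s)) := by
    apply Asymptotics.IsBigO.of_bound C
    have e1 : ∀ᶠ h : ℝ in 𝓝[≠] 0, h ∈ Metric.ball (0:ℝ) 1 :=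
      mem_nhdsWithin_of_mem_nhds (Metric.ball_mem_nhds 0 one_pos)
    have e2 : ∀ᶠ h : ℝ in 𝓝[≠] 0, H (s + h) ∈ Set.Icc (H s / 2) ((H s + 1) / 2) := by
      have hcont : Continuous fun h : ℝ => H (s + h) := by fun_prop
      have ht : Tendsto (fun h : ℝ => H (s + h)) (𝓝 0) (𝓝 (H s)) := by
        simpa using hcont.tendsto 0
      exact (ht.mono_left nhdsWithin_le_nhds) (Icc_mem_nhds (by linarith) (by linarith))
    filter_upwards [self_mem_nhdsWithin, e1, e2] with h hh hl hI
    have hp : 0 < |h| := abs_pos.mpr hh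
    have hl : |h| < 1 := by simpa using hl
    have hHs : H s ∈ Set.Icc (H s / 2) ((H s + 1) / 2) := ⟨by linarith, by linarith⟩
    have key := mv_bound F hb (s + h) (H s) (H (s + h)) (hHrange s) (hHrange _)
      (derivWithin (fun θ => F s θ) (Set.Ioo (0:ℝ) 1) (H s))
      (C * (|h| ^ γ + |H (s + h) - H s|)) ?_
    · rw [norm_mul, Real.norm_of_nonneg (by positivity : 0 ≤ |h| ^ γ + |H (s + h) - H s|),
        ← mul_assoc]
      exact key
    · intro ξ hξ
      have hξI : ξ ∈ Set.Icc (H s / 2) ((H s + 1) / 2) :=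
        Set.uIcc_subset_Icc hHs hI hξ
      have := hCb (s + h) ξ s (H s) ?_ hξI ?_ hHs
      · rw [iteratedDerivWithin_one, iteratedDerivWithin_one] at this
        refine this.trans (mul_le_mul_of_nonneg_left (add_le_add ?_ ?_) hC.le)
        · rw [add_sub_cancel_left]
          apply Real.rpow_le_rpow_of_exponent_ge hp hl.le
          have := le_max_right ξ (H s)
          linarith
        · exact Set.abs_sub_left_of_mem_uIcc hξ
      · rw [Set.mem_Icc, ← abs_le]
        exact (abs_add_le s h).trans (by linarith)
      · rw [Set.mem_Icc, ← abs_le]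
        linarith
  refine hbig.trans_isLittleO ?_
  have h1 : (fun h : ℝ => |h| ^ γ + |H (s + h) - H s|) =O[𝓝[≠] 0] (fun h : ℝ => |h| ^ γ) :=
    (Asymptotics.isBigO_refl _ _).add hδ.isBigO.abs_left
  refine (h1.mul_isLittleO hδ).congr' EventuallyEq.rfl ?_
  filter_upwards [self_mem_nhdsWithin] with h hh
  have hp : 0 < |h| := abs_pos.mpr hh
  rw [← Real.rpow_add hp, two_mul]

/-- Parts (i) and (ii) of the paper's main theorem, for a deterministic field `F`
satisfying the pathwise properties of (a modification of) the generating field of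
multifractional Brownian motion: along the multifractional process
`X(t) = F(t,H(t))`, at points of an open interval `J ⊆ (0,∞)` where
`α_H(s) < H(s) < 2α_H(s)`, the pointwise Hölder exponent of `X` equals `α_H(s)` when
`∂_θF(s,H(s)) ≠ 0`, and equals `H(s)` when `∂_θF(s,H(s)) = 0`. -/
theorem pointwise_holder_exponent_of_multifractional_composition
    (F : ℝ → ℝ → ℝ)
    -- (a)
    (ha : ∀ (s : ℝ), ∀ θ ∈ Set.Ioo (0:ℝ) 1, ∀ ε : ℝ, 0 < ε →
      Filter.Tendsto (fun h : ℝ => |F (s + h) θ - F s θ| / |h| ^ (θ - ε))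
        (𝓝[≠] 0) (𝓝 0) ∧
      ∀ C : ℝ, ∃ᶠ h : ℝ in 𝓝[≠] 0, C < |F (s + h) θ - F s θ| / |h| ^ (θ + ε))
    -- (b)
    (hb : ∀ t : ℝ, ContDiffOn ℝ (⊤ : ℕ∞) (fun θ => F t θ) (Set.Ioo (0:ℝ) 1))
    -- (c)
    (hc : ∀ (n : ℕ) (ε M a b : ℝ), 0 < ε → 0 < M → 0 < a → a < b → b < 1 →
      ∃ C : ℝ, 0 < C ∧
        ∀ t₁ θ₁ t₂ θ₂ : ℝ, t₁ ∈ Set.Icc (-M) M → θ₁ ∈ Set.Icc a b →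
          t₂ ∈ Set.Icc (-M) M → θ₂ ∈ Set.Icc a b →
          |iteratedDerivWithin n (fun θ => F t₁ θ) (Set.Ioo (0:ℝ) 1) θ₁
            - iteratedDerivWithin n (fun θ => F t₂ θ) (Set.Ioo (0:ℝ) 1) θ₂|
            ≤ C * (|t₁ - t₂| ^ (max θ₁ θ₂ - ε) + |θ₁ - θ₂|))
    (H : ℝ → ℝ) (hHcont : Continuous H) (hHrange : ∀ s, H s ∈ Set.Ioo (0:ℝ) 1)
    (c d : ℝ) (hcd : c < d) (hJpos : Set.Ioo c d ⊆ Set.Ioi (0:ℝ))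
    (hA : ∀ s ∈ Set.Ioo c d,
      pointwiseHolderExp H s < H s ∧ H s < 2 * pointwiseHolderExp H s) :
    ∀ s ∈ Set.Ioo c d,
      (derivWithin (fun θ => F s θ) (Set.Ioo (0:ℝ) 1) (H s) ≠ 0 →
        pointwiseHolderExp (fun t => F t (H t)) s = pointwiseHolderExp H s) ∧
      (derivWithin (fun θ => F s θ) (Set.Ioo (0:ℝ) 1) (H s) = 0 →
        pointwiseHolderExp (fun t => F t (H t)) s = H s) := by
  intro s hs
  obtain ⟨hA1, hA2⟩ := hA s hs
  obtain ⟨h0, h1⟩ := hHrange s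
  have hα : 0 < pointwiseHolderExp H s := by linarith
  obtain ⟨hlow, hupp⟩ := exp_spec hα
  set α := pointwiseHolderExp H s with hαdef
  obtain ⟨γ, hγ1, hγ2⟩ := exists_between (show H s / 2 < α by linarith)
  have hR := remainder F hb hc H hHcont hHrange s γ (by linarith) (hlow γ hγ2)
  set D := derivWithin (fun θ => F s θ) (Set.Ioo (0:ℝ) 1) (H s) with hD
  have hFlow : ∀ β, β < H s → HolderLO (fun t => F t (H s)) s β := by
    intro β hβ
    rw [holderLO_iff]
    have := (ha s (H s) (hHrange s) (H s - β) (by linarith)).1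
    simpa using this
  have hFupp : ∀ β, H s < β → ¬ HolderLO (fun t => F t (H s)) s β := by
    intro β hβ hh
    rw [holderLO_iff] at hh
    have h2 := (ha s (H s) (hHrange s) (β - H s) (by linarith)).2 1
    rw [add_sub_cancel] at h2
    have h3 := hh.eventually (gt_mem_nhds one_pos)
    obtain ⟨h, h4, h5⟩ := (h2.and_eventually h3).exists
    exact absurd h4 (not_lt.mpr h5.le)
  have hRle : ∀ β, β ≤ 2 * γ → (fun h : ℝ => F (s + h) (H (s + h)) - F (s + h) (H s)
      - D * (H (s + h) - H s)) =o[𝓝[≠] 0] (fun h : ℝ => |h| ^ β) :=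
    fun β hβ => hR.trans_isBigO (pow_isBigO hβ)
  constructor
  · intro hD0
    apply exp_eq hα
    · intro β hβ
      have := ((hRle β (by linarith)).add (hFlow β (by linarith))).add
        ((hlow β hβ).const_mul_left D)
      refine this.congr_left fun h => ?_
      ring
    · intro β hβ hX
      obtain ⟨β', hβ1, hβ2⟩ := exists_between (lt_min hβ hA1)
      have hb1 := hβ2.trans_le (min_le_left _ _)
      have hb2 := hβ2.trans_le (min_le_right _ _)
      apply hupp β' hβ1
      have hX' : HolderLO (fun t => F t (H t)) s β' := hX.trans_isBigO (pow_isBigO hb1.le)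
      have := ((hX'.sub (hRle β' (by linarith))).sub (hFlow β' hb2)).const_mul_left D⁻¹
      refine this.congr_left fun h => ?_
      field_simp
      ring
  · intro hD0
    rw [hD0] at hRle
    apply exp_eq h0
    · intro β hβ
      have := (hRle β (by linarith)).add (hFlow β (by linarith))
      refine this.congr_left fun h => ?_
      ring
    · intro β hβ hX
      obtain ⟨β', hβ1, hβ2⟩ := exists_between (lt_min hβ (show H s < 2 * γ by linarith))
      have hb1 := hβ2.trans_le (min_le_left _ _)
      have hb2 := hβ2.trans_le (min_le_right _ _)
      apply hFupp β' hβ1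
      have hX' : HolderLO (fun t => F t (H t)) s β' := hX.trans_isBigO (pow_isBigO hb1.le)
      have := hX'.sub (hRle β' hb2.le)
      refine this.congr_left fun h => ?_
      ring

end
end
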